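/- arXiv:2501.03790 — 2 statements merged into one kernel-verified Lean document; each statement's English description precedes it below -/
import Mathlib

section
/- Let n ≥ 2, 0 < s < 1 and 0 < p,q < ∞ with sp ≥ n. Then there exists a continuous function u ∈ Ẇ^{s,p}_q(ℝ^n) such that for every continuous curve γ : [0,∞) → ℝ^n with γ(0) = 0 and |γ(t)| → ∞ as t → ∞, one has u(γ(t)) → ∞ as t → ∞. -/
open MeasureTheory Filter Set
open scoped ENNReal NNReal

noncomputable section

/-- Axis-parallel half-open cube with lower-left corner `a` and edge length `l`. -/
def cube (n : ℕ) (a : EuclideanSpace ℝ (Fin n)) (l : ℝ) : Set (EuclideanSpace ℝ (Fin n)) :=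
  {x | ∀ i, a i ≤ x i ∧ x i < a i + l}

/-- The median of `u` over a set `A`. -/
def median (n : ℕ) (u : EuclideanSpace ℝ (Fin n) → ℝ)
    (A : Set (EuclideanSpace ℝ (Fin n))) : ℝ :=
  sSup {M : ℝ | volume A / 2 ≤ volume {x ∈ A | u x < M}}

/-- The precise representative: `limsup` of medians over cubes containing `x`,
as the edge length tends to `0` from the right. -/
def preciseRep (n : ℕ) (u : EuclideanSpace ℝ (Fin n) → ℝ)
    (x : EuclideanSpace ℝ (Fin n)) : ℝ :=
  Filter.limsup (fun al : EuclideanSpace ℝ (Fin n) × ℝ => median n u (cube n al.1 al.2))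
    ((Filter.comap Prod.snd (nhdsWithin 0 (Set.Ioi 0))) ⊓
      Filter.principal {al : EuclideanSpace ℝ (Fin n) × ℝ | x ∈ cube n al.1 al.2})

/-- The `p`-th power of the homogeneous `W^{s,p}_q` seminorm. -/
def fracEnergy (n : ℕ) (s p q : ℝ) (u : EuclideanSpace ℝ (Fin n) → ℝ) : ℝ≥0∞ :=
  ∫⁻ x, (∫⁻ y, ENNReal.ofReal (|u x - u y| ^ q / ‖x - y‖ ^ ((n : ℝ) + s * q))) ^ (p / q)

/-- Membership in the homogeneous fractional Sobolev space `Ẇ^{s,p}_q(ℝⁿ)`. -/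
def MemHomFrac (n : ℕ) (s p q : ℝ) (u : EuclideanSpace ℝ (Fin n) → ℝ) : Prop :=
  Measurable u ∧ fracEnergy n s p q u < ⊤

/-- The `W^{s,p}_q` norm: `L^p` norm plus the seminorm. -/
def fracNorm (n : ℕ) (s p q : ℝ) (u : EuclideanSpace ℝ (Fin n) → ℝ) : ℝ≥0∞ :=
  eLpNorm u (ENNReal.ofReal p) volume + (fracEnergy n s p q u) ^ (1 / p)

/-- The `lam`-dimensional Hausdorff content. -/
def hContent (n : ℕ) (lam : ℝ) (A : Set (EuclideanSpace ℝ (Fin n))) : ℝ≥0∞ :=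
  ⨅ (B : ℕ → Set (EuclideanSpace ℝ (Fin n))) (_ : A ⊆ ⋃ j, B j),
    ∑' j, EMetric.diam (B j) ^ lam

/-- A set `E ⊂ ℝⁿ` is `(p,s)`-thin at infinity. -/
def ThinAtInfinity (n : ℕ) (p s : ℝ) (E : Set (EuclideanSpace ℝ (Fin n))) : Prop :=
  ∀ lam : ℝ, (n : ℝ) - s * p < lam →
    Filter.Tendsto (fun m : ℕ => hContent n lam (E \ Metric.ball 0 (m : ℝ)))
      Filter.atTop (nhds 0)

/-- Integration in polar coordinates for nonnegative radial functions. -/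
theorem lintegral_ofReal_radial (n : ℕ) [NeZero n] {g : ℝ → ℝ} (hg : ∀ r, 0 ≤ g r)
    (hint : IntegrableOn (fun y : ℝ => y ^ (n - 1) * g y) (Ioi 0)) :
    ∫⁻ x : EuclideanSpace ℝ (Fin n), ENNReal.ofReal (g ‖x‖) =
      ENNReal.ofReal (n * (volume.real (Metric.ball (0 : EuclideanSpace ℝ (Fin n)) 1) *
        ∫ y in Ioi (0 : ℝ), y ^ (n - 1) * g y)) := by
  have h1 : Integrable (fun x : EuclideanSpace ℝ (Fin n) => g ‖x‖) := by
    rw [integrable_fun_norm_addHaar volume (f := g)]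
    simpa using hint
  rw [← ofReal_integral_eq_lintegral_ofReal h1 (ae_of_all _ fun x => hg _),
    integral_fun_norm_addHaar volume g]
  simp

/-- The surface measure of the unit sphere. -/
def sphereConst (n : ℕ) : ℝ :=
  n * volume.real (Metric.ball (0 : EuclideanSpace ℝ (Fin n)) 1)

theorem sphereConst_nonneg (n : ℕ) : 0 ≤ sphereConst n := by
  unfold sphereConst; positivity

theorem pow_pred_mul_rpow {n : ℕ} [NeZero n] {y : ℝ} (hy : 0 < y) (b : ℝ) :
    y ^ (n - 1) * y ^ (b - n) = y ^ (b - 1) := by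
  have hn : 1 ≤ n := NeZero.one_le
  rw [← Real.rpow_natCast, ← Real.rpow_add hy, Nat.cast_sub hn]
  congr 1
  push_cast; ring

theorem lintegral_rpow_near_zero (n : ℕ) [NeZero n] {a T : ℝ} (ha : 0 < a) (hT : 0 < T) :
    ∫⁻ x : EuclideanSpace ℝ (Fin n),
      ENNReal.ofReal ((Iic T).indicator (fun r : ℝ => r ^ (a - n)) ‖x‖) =
        ENNReal.ofReal (sphereConst n * (T ^ a / a)) := by
  have hEq : EqOn (fun y : ℝ => y ^ (n - 1) * (Iic T).indicator (fun r => |r| ^ (a - n)) y)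
      ((Iic T).indicator fun y => y ^ (a - 1)) (Ioi 0) := by
    intro y hy
    have hy' : 0 < y := hy
    by_cases h : y ≤ T
    · simp [h, abs_of_pos hy', pow_pred_mul_rpow hy' a]
    · simp [h]
  have hI : IntegrableOn ((Iic T).indicator fun y : ℝ => y ^ (a - 1)) (Ioi 0) := by
    rw [integrableOn_indicator_iff measurableSet_Iic, Iic_inter_Ioi]
    exact (intervalIntegrable_iff_integrableOn_Ioc_of_le hT.le).1
      (intervalIntegral.intervalIntegrable_rpow' (by linarith))
  have hV : ∫ y in Ioi (0 : ℝ), y ^ (n - 1) * (Iic T).indicator (fun r => |r| ^ (a - n)) y =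
      T ^ a / a := by
    rw [setIntegral_congr_fun measurableSet_Ioi hEq, setIntegral_indicator measurableSet_Iic,
      Ioi_inter_Iic, ← intervalIntegral.integral_of_le hT.le, integral_rpow (by left; linarith)]
    simp [ha.ne']
  have := lintegral_ofReal_radial n (g := (Iic T).indicator (fun r : ℝ => |r| ^ (a - n)))
    (fun r => indicator_nonneg (fun _ _ => by positivity) _)
    (hI.congr_fun hEq.symm measurableSet_Ioi)
  rw [hV, ← mul_assoc] at this
  rw [sphereConst, ← this]
  congr with x
  by_cases h : ‖x‖ ≤ T <;> simp [h]

theorem lintegral_rpow_near_infty (n : ℕ) [NeZero n] {a T : ℝ} (ha : 0 < a) (hT : 0 < T) :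
    ∫⁻ x : EuclideanSpace ℝ (Fin n),
      ENNReal.ofReal ((Ioi T).indicator (fun r : ℝ => r ^ (-a - n)) ‖x‖) =
        ENNReal.ofReal (sphereConst n * (T ^ (-a) / a)) := by
  have hEq : EqOn (fun y : ℝ => y ^ (n - 1) * (Ioi T).indicator (fun r => r ^ (-a - n)) y)
      ((Ioi T).indicator fun y => y ^ (-a - 1)) (Ioi 0) := by
    intro y hy
    have hy' : 0 < y := hy
    by_cases h : T < y
    · simp [h, pow_pred_mul_rpow hy' (-a)]
    · simp [h]
  have hI : IntegrableOn ((Ioi T).indicator fun y : ℝ => y ^ (-a - 1)) (Ioi 0) := by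
    rw [integrableOn_indicator_iff measurableSet_Ioi]
    exact (integrableOn_Ioi_rpow_of_lt (by linarith) hT).mono_set inter_subset_left
  have hV : ∫ y in Ioi (0 : ℝ), y ^ (n - 1) * (Ioi T).indicator (fun r => r ^ (-a - n)) y =
      T ^ (-a) / a := by
    rw [setIntegral_congr_fun measurableSet_Ioi hEq, setIntegral_indicator measurableSet_Ioi,
      Ioi_inter_Ioi, sup_eq_right.2 hT.le, integral_Ioi_rpow_of_lt (by linarith) hT]
    simp
  have := lintegral_ofReal_radial n (g := (Ioi T).indicator (fun r : ℝ => r ^ (-a - n)))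
    (fun r => indicator_nonneg (fun y hy => Real.rpow_nonneg (hT.trans hy).le _) _)
    (hI.congr_fun hEq.symm measurableSet_Ioi)
  rw [hV, ← mul_assoc] at this
  rw [sphereConst, ← this]

theorem mul_one_add_le_exp {e t : ℝ} (he : 0 < e) (ht : 0 ≤ t) :
    t * (1 + t) ≤ (2 / e * (1 + 2 / e)) * Real.exp (e * t) := by
  have h1 : e / 2 * t + 1 ≤ Real.exp (e / 2 * t) := Real.add_one_le_exp _
  have h2 : Real.exp (e * t) = Real.exp (e / 2 * t) * Real.exp (e / 2 * t) := by
    rw [← Real.exp_add]; ring_nf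
  have h0 : 0 ≤ e / 2 * t := by positivity
  have h3 : t ≤ 2 / e * Real.exp (e / 2 * t) := by
    rw [div_mul_eq_mul_div, le_div_iff₀ he]; linarith
  have h4 : 1 + t ≤ (1 + 2 / e) * Real.exp (e / 2 * t) := by
    rw [add_mul]; linarith
  calc t * (1 + t) ≤ (2 / e * Real.exp (e / 2 * t)) * ((1 + 2 / e) * Real.exp (e / 2 * t)) := by
        gcongr
    _ = _ := by rw [h2]; ring

theorem abs_log_sub_log_le {a b : ℝ} (ha : 1 ≤ a) (hb : 1 ≤ b) :
    |Real.log a - Real.log b| ≤ |a - b| * (1 + |a - b|) / a := by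
  have ha0 : 0 < a := by linarith
  have hb0 : 0 < b := by linarith
  rw [le_div_iff₀ ha0]
  rcases le_total a b with h | h
  · have hl : Real.log b - Real.log a ≤ b / a - 1 := by
      rw [← Real.log_div hb0.ne' ha0.ne']
      exact Real.log_le_sub_one_of_pos (by positivity)
    have h5 : 0 ≤ Real.log b - Real.log a := sub_nonneg.2 (Real.log_le_log ha0 h)
    rw [abs_sub_comm, abs_of_nonneg h5, abs_sub_comm, abs_of_nonneg (sub_nonneg.2 h)]
    have h6 : (b / a - 1) * a = b - a := by field_simp
    nlinarith [mul_le_mul_of_nonneg_right hl ha0.le]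
  · have hl : Real.log a - Real.log b ≤ a / b - 1 := by
      rw [← Real.log_div ha0.ne' hb0.ne']
      exact Real.log_le_sub_one_of_pos (by positivity)
    have h5 : 0 ≤ Real.log a - Real.log b := sub_nonneg.2 (Real.log_le_log hb0 h)
    rw [abs_of_nonneg h5, abs_of_nonneg (sub_nonneg.2 h)]
    have h7 : a / b - 1 ≤ a - b := by
      rw [div_sub_one hb0.ne', div_le_iff₀ hb0]; nlinarith
    have h8 : a / b ≤ 1 + (a - b) := by linarith
    have h6 : (a / b - 1) * a = (a - b) * (a / b) := by field_simp
    nlinarith [mul_le_mul_of_nonneg_right hl ha0.le,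
      mul_le_mul_of_nonneg_left h8 (sub_nonneg.2 h)]

/-- The iterated logarithm `x ↦ log log (e + ‖x‖)`. -/
def logLog (n : ℕ) (x : EuclideanSpace ℝ (Fin n)) : ℝ :=
  Real.log (Real.log (Real.exp 1 + ‖x‖))

theorem one_le_exp_one_add {r : ℝ} (hr : 0 ≤ r) : 1 ≤ Real.exp 1 + r := by
  have := Real.add_one_le_exp (1 : ℝ)
  linarith

theorem one_le_log_exp_one_add {r : ℝ} (hr : 0 ≤ r) : 1 ≤ Real.log (Real.exp 1 + r) := by
  rw [Real.le_log_iff_exp_le (by positivity)]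
  linarith

theorem continuous_logLog (n : ℕ) : Continuous (logLog n) := by
  unfold logLog
  refine Continuous.log (Continuous.log (by fun_prop) fun x => ?_) fun x => ?_
  · positivity
  · have := one_le_log_exp_one_add (norm_nonneg x)
    positivity

theorem logLog_sub_rpow_le_near {n : ℕ} {s q : ℝ} (hq : 0 < q)
    {x y : EuclideanSpace ℝ (Fin n)} (hxy : x ≠ y)
    (h : ‖x - y‖ ≤ (Real.exp 1 + ‖x‖) / 2) :
    |logLog n x - logLog n y| ^ q / ‖x - y‖ ^ ((n : ℝ) + s * q) ≤
      4 ^ q * (Real.exp 1 + ‖x‖) ^ (-q) * Real.log (Real.exp 1 + ‖x‖) ^ (-q) *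
        ‖x - y‖ ^ ((q - s * q) - n) := by
  have hL := one_le_log_exp_one_add (norm_nonneg x)
  have hD := abs_log_sub_log_le hL (one_le_log_exp_one_add (norm_nonneg y))
  have hR := one_le_exp_one_add (norm_nonneg x)
  have hρ := one_le_exp_one_add (norm_nonneg y)
  have hd : 0 < ‖x - y‖ := norm_pos_iff.2 (sub_ne_zero.2 hxy)
  have hxy1 := abs_le.1 (abs_norm_sub_norm_le x y)
  change |logLog n x - logLog n y| ≤ _ at hD
  set R := Real.exp 1 + ‖x‖ with hRdef
  set ρ := Real.exp 1 + ‖y‖ with hρdef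
  set d := ‖x - y‖
  have hR0 : 0 < R := by linarith
  have hρ0 : 0 < ρ := by linarith
  have hτ : |Real.log R - Real.log ρ| ≤ 2 * d / R := by
    have e1 : R - d ≤ ρ := by linarith
    have e2 : ρ ≤ R + d := by linarith
    rw [abs_le]
    constructor
    · have : Real.log ρ - Real.log R ≤ ρ / R - 1 := by
        rw [← Real.log_div hρ0.ne' hR0.ne']
        exact Real.log_le_sub_one_of_pos (by positivity)
      have h3 : ρ / R - 1 ≤ 2 * d / R := by
        rw [div_sub_one hR0.ne']
        gcongr
        linarith
      linarith
    · have : Real.log R - Real.log ρ ≤ R / ρ - 1 := by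
        rw [← Real.log_div hR0.ne' hρ0.ne']
        exact Real.log_le_sub_one_of_pos (by positivity)
      refine this.trans ?_
      rw [div_sub_one hρ0.ne', div_le_div_iff₀ hρ0 hR0]
      nlinarith
  have hτ1 : 2 * d / R ≤ 1 := by
    rw [div_le_one hR0]; linarith
  have hD2 : |logLog n x - logLog n y| ≤ 4 * R⁻¹ * (Real.log R)⁻¹ * d := by
    refine hD.trans ?_
    calc _ ≤ 2 * d / R * (1 + 1) / Real.log R := by
          gcongr
          exact hτ.trans hτ1
      _ = _ := by field_simp; ring
  calc _ ≤ (4 * R⁻¹ * (Real.log R)⁻¹ * d) ^ q / d ^ ((n : ℝ) + s * q) := by gcongr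
    _ = _ := by
      have hL0 : 0 < Real.log R := by linarith
      rw [Real.mul_rpow (by positivity) hd.le, Real.mul_rpow (by positivity) (by positivity),
        Real.mul_rpow (by positivity) (by positivity), Real.inv_rpow hR0.le,
        Real.inv_rpow hL0.le, ← Real.rpow_neg hR0.le, ← Real.rpow_neg hL0.le, mul_div_assoc,
        ← Real.rpow_sub hd]
      congr 2
      ring

theorem logLog_sub_rpow_le_exp {n : ℕ} {q e : ℝ} (hq : 0 < q) (he : 0 < e)
    (x y : EuclideanSpace ℝ (Fin n)) :
    |logLog n x - logLog n y| ^ q ≤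
      (2 / e * (1 + 2 / e)) ^ q * Real.log (Real.exp 1 + ‖x‖) ^ (-q) *
        Real.exp (e * q * |Real.log (Real.exp 1 + ‖x‖) - Real.log (Real.exp 1 + ‖y‖)|) := by
  have hL := one_le_log_exp_one_add (norm_nonneg x)
  have hD := abs_log_sub_log_le hL (one_le_log_exp_one_add (norm_nonneg y))
  change |logLog n x - logLog n y| ≤ _ at hD
  set t := |Real.log (Real.exp 1 + ‖x‖) - Real.log (Real.exp 1 + ‖y‖)| with ht
  set L := Real.log (Real.exp 1 + ‖x‖)
  have hL0 : 0 < L := by linarith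
  have h1 := mul_one_add_le_exp he (abs_nonneg _ : 0 ≤ t)
  have h2 : |logLog n x - logLog n y| ≤ (2 / e * (1 + 2 / e)) * L⁻¹ * Real.exp (e * t) := by
    refine hD.trans ?_
    rw [div_eq_mul_inv, mul_right_comm _ L⁻¹]
    gcongr
  calc _ ≤ ((2 / e * (1 + 2 / e)) * L⁻¹ * Real.exp (e * t)) ^ q := by gcongr
    _ = _ := by
      rw [Real.mul_rpow (by positivity) (by positivity), Real.mul_rpow (by positivity)
        (by positivity), Real.inv_rpow hL0.le, ← Real.rpow_neg hL0.le, ← Real.exp_mul]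
      congr 2
      ring

theorem logLog_sub_rpow_le_far {n : ℕ} {s q : ℝ} (hs : 0 < s) (hq : 0 < q)
    {x y : EuclideanSpace ℝ (Fin n)}
    (h : (Real.exp 1 + ‖x‖) / 2 < ‖x - y‖) (hle : ‖x‖ ≤ ‖y‖) :
    |logLog n x - logLog n y| ^ q / ‖x - y‖ ^ ((n : ℝ) + s * q) ≤
      (2 / (s / 2) * (1 + 2 / (s / 2))) ^ q * 3 ^ (s / 2 * q) *
        (Real.exp 1 + ‖x‖) ^ (-(s / 2 * q)) * Real.log (Real.exp 1 + ‖x‖) ^ (-q) *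
        ‖x - y‖ ^ (-(s / 2 * q) - n) := by
  have hB := logLog_sub_rpow_le_exp hq (half_pos hs) x y
  have hL := one_le_log_exp_one_add (norm_nonneg x)
  have hR := one_le_exp_one_add (norm_nonneg x)
  have hρ := one_le_exp_one_add (norm_nonneg y)
  have hxy1 := abs_le.1 (abs_norm_sub_norm_le x y)
  set K := (2 / (s / 2) * (1 + 2 / (s / 2))) ^ q with hK
  have hK0 : 0 ≤ K := by positivity
  set R := Real.exp 1 + ‖x‖ with hRdef
  set ρ := Real.exp 1 + ‖y‖ with hρdef
  set d := ‖x - y‖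
  have hR0 : 0 < R := by linarith
  have hρ0 : 0 < ρ := by linarith
  have hd : 0 < d := by linarith
  have hL0 : 0 < Real.log R := by linarith
  have hE : Real.exp (s / 2 * q * |Real.log R - Real.log ρ|) ≤ (3 * d * R⁻¹) ^ (s / 2 * q) := by
    rw [abs_sub_comm, abs_of_nonneg (sub_nonneg.2 (Real.log_le_log hR0 (by linarith))),
      ← Real.log_div hρ0.ne' hR0.ne', mul_comm (s / 2 * q), ← Real.rpow_def_of_pos (by positivity),
      div_eq_mul_inv]
    gcongr
    linarith
  calc _ ≤ (K * Real.log R ^ (-q) * (3 * d * R⁻¹) ^ (s / 2 * q)) / d ^ ((n : ℝ) + s * q) := by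
        gcongr
        exact hB.trans (by gcongr)
    _ = _ := by
      have : -(s / 2 * q) - n = s / 2 * q - ((n : ℝ) + s * q) := by ring
      rw [Real.mul_rpow (by positivity) (by positivity), Real.mul_rpow (by positivity)
        (by positivity), Real.inv_rpow hR0.le, ← Real.rpow_neg hR0.le, this, Real.rpow_sub hd]
      ring

theorem logLog_sub_rpow_le_inner {n : ℕ} [NeZero n] {s q : ℝ} (hs : 0 < s) (hq : 0 < q)
    {x y : EuclideanSpace ℝ (Fin n)} (hy : y ≠ 0)
    (h : (Real.exp 1 + ‖x‖) / 2 < ‖x - y‖) (hle : ‖y‖ ≤ ‖x‖) :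
    |logLog n x - logLog n y| ^ q / ‖x - y‖ ^ ((n : ℝ) + s * q) ≤
      (2 / (n / 2 / q) * (1 + 2 / (n / 2 / q))) ^ q * 2 ^ ((n : ℝ) + s * q) *
        (Real.exp 1 + ‖x‖) ^ (-((n : ℝ) / 2 + s * q)) * Real.log (Real.exp 1 + ‖x‖) ^ (-q) *
        ‖y‖ ^ ((n : ℝ) / 2 - n) := by
  have hn : (0 : ℝ) < n := Nat.cast_pos.2 (NeZero.pos n)
  have hB := logLog_sub_rpow_le_exp hq (e := n / 2 / q) (by positivity) x y
  have hL := one_le_log_exp_one_add (norm_nonneg x)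
  have hR := one_le_exp_one_add (norm_nonneg x)
  have hρ := one_le_exp_one_add (norm_nonneg y)
  have hy0 : 0 < ‖y‖ := norm_pos_iff.2 hy
  set K := (2 / (n / 2 / q) * (1 + 2 / (n / 2 / q))) ^ q with hK
  have hK0 : 0 ≤ K := by positivity
  set R := Real.exp 1 + ‖x‖ with hRdef
  set ρ := Real.exp 1 + ‖y‖ with hρdef
  set d := ‖x - y‖
  have hR0 : 0 < R := by linarith
  have hρ0 : 0 < ρ := by linarith
  have hL0 : 0 < Real.log R := by linarith
  have hE : Real.exp (n / 2 / q * q * |Real.log R - Real.log ρ|) ≤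
      (R * ‖y‖⁻¹) ^ ((n : ℝ) / 2) := by
    rw [abs_of_nonneg (sub_nonneg.2 (Real.log_le_log hρ0 (by linarith))),
      ← Real.log_div hR0.ne' hρ0.ne', mul_comm (_ * q), div_mul_cancel₀ _ hq.ne',
      ← Real.rpow_def_of_pos (by positivity), div_eq_mul_inv]
    gcongr
    exact le_add_of_nonneg_left (by positivity)
  calc _ ≤ (K * Real.log R ^ (-q) * (R * ‖y‖⁻¹) ^ ((n : ℝ) / 2)) /
        (R * 2⁻¹) ^ ((n : ℝ) + s * q) := by
        rw [div_eq_mul_inv] at h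
        gcongr
        exact hB.trans (by gcongr)
    _ = _ := by
      have e1 : (n : ℝ) / 2 - n = - (n / 2) := by ring
      have e2 : -((n : ℝ) / 2 + s * q) = n / 2 - (n + s * q) := by ring
      rw [Real.mul_rpow (by positivity) (by positivity), Real.mul_rpow (by positivity)
        (by positivity), Real.inv_rpow hy0.le, ← Real.rpow_neg hy0.le, e1, e2, Real.rpow_sub hR0,
        Real.inv_rpow two_pos.le]
      field_simp

theorem exists_inner_lintegral_le (n : ℕ) [NeZero n] {s q : ℝ} (hs0 : 0 < s) (hs1 : s < 1)
    (hq : 0 < q) :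
    ∃ C : ℝ, 0 ≤ C ∧ ∀ x : EuclideanSpace ℝ (Fin n),
      ∫⁻ y, ENNReal.ofReal (|logLog n x - logLog n y| ^ q / ‖x - y‖ ^ ((n : ℝ) + s * q)) ≤
        ENNReal.ofReal (C * (Real.exp 1 + ‖x‖) ^ (-(s * q)) *
          Real.log (Real.exp 1 + ‖x‖) ^ (-q)) := by
  have hn : (0 : ℝ) < n := Nat.cast_pos.2 (NeZero.pos n)
  set cA : ℝ := 4 ^ q with hcA
  set cB : ℝ := (2 / (s / 2) * (1 + 2 / (s / 2))) ^ q * 3 ^ (s / 2 * q) with hcB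
  set cC : ℝ := (2 / (n / 2 / q) * (1 + 2 / (n / 2 / q))) ^ q * 2 ^ ((n : ℝ) + s * q) with hcC
  have hA0 : 0 ≤ cA := by positivity
  have hB0 : 0 ≤ cB := by positivity
  have hC0 : 0 ≤ cC := by positivity
  have hσ := sphereConst_nonneg n
  have ha : 0 < q - s * q := by nlinarith
  have hb : 0 < s / 2 * q := by positivity
  refine ⟨cA * sphereConst n * (2⁻¹ ^ (q - s * q) / (q - s * q)) +
    cB * sphereConst n * (2⁻¹ ^ (-(s / 2 * q)) / (s / 2 * q)) +
    cC * sphereConst n * (1 / (n / 2)), by positivity, fun x => ?_⟩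
  have hR := one_le_exp_one_add (norm_nonneg x)
  have hL := one_le_log_exp_one_add (norm_nonneg x)
  have near := fun y (hxy : x ≠ y) => logLog_sub_rpow_le_near (s := s) hq (x := x) (y := y) hxy
  have far := fun y => logLog_sub_rpow_le_far hs0 hq (x := x) (y := y)
  have inn := fun y (hy : y ≠ 0) => logLog_sub_rpow_le_inner hs0 hq (x := x) (y := y) hy
  have hxR : ‖x‖ ≤ Real.exp 1 + ‖x‖ := le_add_of_nonneg_left (by positivity)
  rw [← hcA] at near
  rw [← hcB] at far
  rw [← hcC] at inn
  set R := Real.exp 1 + ‖x‖ with hRdef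
  set L := Real.log R
  have hR0 : 0 < R := by linarith
  have hL0 : 0 < L := by linarith
  set fA : EuclideanSpace ℝ (Fin n) → ℝ≥0∞ := fun y =>
    ENNReal.ofReal ((Iic (R * 2⁻¹)).indicator (fun r : ℝ => r ^ (q - s * q - n)) ‖y‖) with hfA
  set fB : EuclideanSpace ℝ (Fin n) → ℝ≥0∞ := fun y =>
    ENNReal.ofReal ((Ioi (R * 2⁻¹)).indicator (fun r : ℝ => r ^ (-(s / 2 * q) - n)) ‖y‖) with hfB
  set fC : EuclideanSpace ℝ (Fin n) → ℝ≥0∞ := fun y =>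
    ENNReal.ofReal ((Iic R).indicator (fun r : ℝ => r ^ ((n : ℝ) / 2 - n)) ‖y‖) with hfC
  have mA : Measurable fA :=
    (((by fun_prop : Measurable fun r : ℝ => r ^ (q - s * q - n)).indicator
      measurableSet_Iic).comp measurable_norm).ennreal_ofReal
  have mB : Measurable fB :=
    (((by fun_prop : Measurable fun r : ℝ => r ^ (-(s / 2 * q) - n)).indicator
      measurableSet_Ioi).comp measurable_norm).ennreal_ofReal
  have mC : Measurable fC :=
    (((by fun_prop : Measurable fun r : ℝ => r ^ ((n : ℝ) / 2 - n)).indicator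
      measurableSet_Iic).comp measurable_norm).ennreal_ofReal
  have hpt : ∀ᵐ y : EuclideanSpace ℝ (Fin n),
      ENNReal.ofReal (|logLog n x - logLog n y| ^ q / ‖x - y‖ ^ ((n : ℝ) + s * q)) ≤
        ENNReal.ofReal (cA * R ^ (-q) * L ^ (-q)) * fA (x - y) +
        ENNReal.ofReal (cB * R ^ (-(s / 2 * q)) * L ^ (-q)) * fB (x - y) +
        ENNReal.ofReal (cC * R ^ (-((n : ℝ) / 2 + s * q)) * L ^ (-q)) * fC y := by
    filter_upwards [Measure.ae_ne volume x, Measure.ae_ne volume 0] with y hyx hy0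
    rcases le_or_gt ‖x - y‖ (R / 2) with h | h
    · refine (ENNReal.ofReal_le_ofReal (near y hyx.symm h)).trans ?_
      rw [add_assoc]
      refine le_add_right ?_
      rw [ENNReal.ofReal_mul (by positivity)]
      rw [div_eq_mul_inv] at h
      simp [hfA, h]
    · rcases le_total ‖x‖ ‖y‖ with h' | h'
      · refine (ENNReal.ofReal_le_ofReal (far y h h')).trans ?_
        refine le_add_right (le_add_left ?_)
        rw [ENNReal.ofReal_mul (by positivity)]
        rw [div_eq_mul_inv] at h
        simp [hfB, h]
      · refine (ENNReal.ofReal_le_ofReal (inn y hy0 h h')).trans ?_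
        refine le_add_left ?_
        rw [ENNReal.ofReal_mul (by positivity)]
        simp [hfC, h'.trans hxR]
  refine (lintegral_mono_ae hpt).trans (le_of_eq ?_)
  have mA' : Measurable fun y => fA (x - y) := mA.comp (by fun_prop)
  have mB' : Measurable fun y => fB (x - y) := mB.comp (by fun_prop)
  rw [lintegral_add_right _ (by fun_prop), lintegral_add_right _ (by fun_prop),
    lintegral_const_mul _ mA', lintegral_const_mul _ mB', lintegral_const_mul _ mC,
    lintegral_sub_left_eq_self fA x, lintegral_sub_left_eq_self fB x,
    lintegral_rpow_near_zero n ha (by positivity), lintegral_rpow_near_infty n hb (by positivity),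
    lintegral_rpow_near_zero n (half_pos hn) hR0,
    ← ENNReal.ofReal_mul (by positivity), ← ENNReal.ofReal_mul (by positivity),
    ← ENNReal.ofReal_mul (by positivity), ← ENNReal.ofReal_add (by positivity) (by positivity),
    ← ENNReal.ofReal_add (by positivity) (by positivity)]
  congr 1
  have e1 : R ^ (-q) * R ^ (q - s * q) = R ^ (-(s * q)) := by
    rw [← Real.rpow_add hR0]; ring_nf
  have e2 : R ^ (-(s / 2 * q)) * R ^ (-(s / 2 * q)) = R ^ (-(s * q)) := by
    rw [← Real.rpow_add hR0]; ring_nf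
  have e3 : R ^ (-((n : ℝ) / 2 + s * q)) * R ^ ((n : ℝ) / 2) = R ^ (-(s * q)) := by
    rw [← Real.rpow_add hR0]; ring_nf
  rw [Real.mul_rpow hR0.le (by norm_num), Real.mul_rpow hR0.le (by norm_num)]
  linear_combination (L ^ (-q) * cA * sphereConst n * (2⁻¹ ^ (q - s * q) / (q - s * q))) * e1 +
    (L ^ (-q) * cB * sphereConst n * (2⁻¹ ^ (-(s / 2 * q)) / (s / 2 * q))) * e2 +
    (L ^ (-q) * cC * sphereConst n * (1 / (n / 2))) * e3

theorem integrableOn_inv_mul_log_rpow {p : ℝ} (hp : 1 < p) :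
    IntegrableOn (fun r : ℝ => (Real.exp 1 + r)⁻¹ * Real.log (Real.exp 1 + r) ^ (-p)) (Ioi 0) := by
  have hd : ∀ r ∈ Ici (0 : ℝ), HasDerivAt
      (fun r : ℝ => Real.log (Real.exp 1 + r) ^ (1 - p) / (1 - p))
      ((Real.exp 1 + r)⁻¹ * Real.log (Real.exp 1 + r) ^ (-p)) r := by
    intro r hr
    have hr' : 0 ≤ r := hr
    have hL := one_le_log_exp_one_add hr'
    have h1 : HasDerivAt (fun r : ℝ => Real.log (Real.exp 1 + r)) (1 / (Real.exp 1 + r)) r :=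
      ((hasDerivAt_id r).const_add _).log (by positivity)
    have h2 := (h1.rpow_const (p := 1 - p) (Or.inl (by positivity))).div_const (1 - p)
    have hp' : 1 - p ≠ 0 := by linarith
    refine h2.congr_deriv ?_
    rw [show 1 - p - 1 = -p by ring]
    field_simp
  refine integrableOn_Ioi_deriv_of_nonneg' (l := 0 / (1 - p)) hd (fun r hr => ?_) ?_
  · have hr' : 0 < r := hr
    have hL := one_le_log_exp_one_add hr'.le
    positivity
  · have h3 : Tendsto (fun y : ℝ => y ^ (1 - p)) atTop (nhds 0) := by
      simpa using tendsto_rpow_neg_atTop (y := p - 1) (by linarith)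
    exact ((h3.comp (Real.tendsto_log_atTop.comp
      (tendsto_atTop_add_const_left _ _ tendsto_id))).div_const _)

theorem lintegral_rpow_mul_log_lt_top (n : ℕ) [NeZero n] {p : ℝ} (hp : 1 < p) :
    ∫⁻ x : EuclideanSpace ℝ (Fin n), ENNReal.ofReal ((Real.exp 1 + ‖x‖) ^ (-(n : ℝ)) *
      Real.log (Real.exp 1 + ‖x‖) ^ (-p)) < ⊤ := by
  have key : IntegrableOn (fun y : ℝ => y ^ (n - 1) * ((Real.exp 1 + |y|) ^ (-(n : ℝ)) *
      Real.log (Real.exp 1 + |y|) ^ (-p))) (Ioi 0) := by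
    refine Integrable.mono' (integrableOn_inv_mul_log_rpow hp) (by fun_prop) ?_
    refine (ae_restrict_iff' measurableSet_Ioi).2 (ae_of_all _ fun y hy => ?_)
    have hy' : 0 < y := hy
    have hL := one_le_log_exp_one_add hy'.le
    have hE : 0 < Real.exp 1 + y := by positivity
    rw [abs_of_pos hy', Real.norm_of_nonneg (by positivity), ← mul_assoc]
    gcongr
    calc y ^ (n - 1) * (Real.exp 1 + y) ^ (-(n : ℝ))
        ≤ (Real.exp 1 + y) ^ (n - 1) * (Real.exp 1 + y) ^ (-(n : ℝ)) := by
          gcongr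
          exact le_add_of_nonneg_left (by positivity)
      _ = (Real.exp 1 + y)⁻¹ := by
          have := pow_pred_mul_rpow (n := n) hE 0
          rwa [zero_sub, zero_sub, Real.rpow_neg_one] at this
  have := lintegral_ofReal_radial n (g := fun y : ℝ => (Real.exp 1 + |y|) ^ (-(n : ℝ)) *
      Real.log (Real.exp 1 + |y|) ^ (-p)) (fun r => by
        have hL := one_le_log_exp_one_add (abs_nonneg r)
        positivity) key
  simp only [abs_norm] at this
  rw [this]
  exact ENNReal.ofReal_lt_top

theorem fracEnergy_logLog_lt_top (n : ℕ) [NeZero n] {s p q : ℝ} (hs0 : 0 < s) (hs1 : s < 1)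
    (hp : 1 < p) (hq : 0 < q) (hspn : (n : ℝ) ≤ s * p) :
    fracEnergy n s p q (logLog n) < ⊤ := by
  obtain ⟨C, hC, h⟩ := exists_inner_lintegral_le n hs0 hs1 hq
  have hpq : 0 < p / q := by positivity
  calc fracEnergy n s p q (logLog n)
      ≤ ∫⁻ x : EuclideanSpace ℝ (Fin n), ENNReal.ofReal (C ^ (p / q)) *
        ENNReal.ofReal ((Real.exp 1 + ‖x‖) ^ (-(n : ℝ)) *
          Real.log (Real.exp 1 + ‖x‖) ^ (-p)) := by
        refine lintegral_mono fun x => ?_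
        refine (ENNReal.rpow_le_rpow (h x) hpq.le).trans ?_
        have hR := one_le_exp_one_add (norm_nonneg x)
        have hL := one_le_log_exp_one_add (norm_nonneg x)
        rw [ENNReal.ofReal_rpow_of_nonneg (by positivity) hpq.le, ← ENNReal.ofReal_mul
          (by positivity), Real.mul_rpow (by positivity) (by positivity),
          Real.mul_rpow (by positivity) (by positivity), ← Real.rpow_mul (by positivity),
          ← Real.rpow_mul (by positivity), mul_assoc]
        refine ENNReal.ofReal_le_ofReal ?_
        have e1 : -(s * q) * (p / q) = -(s * p) := by field_simp
        have e2 : -q * (p / q) = -p := by field_simp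
        rw [e1, e2]
        gcongr
    _ < ⊤ := by
        rw [lintegral_const_mul' _ _ ENNReal.ofReal_ne_top]
        exact ENNReal.mul_lt_top ENNReal.ofReal_lt_top (lintegral_rpow_mul_log_lt_top n hp)

theorem stmt7 (n : ℕ) (hn : 2 ≤ n) (s p q : ℝ) (hs0 : 0 < s) (hs1 : s < 1)
    (hp : 0 < p) (hq : 0 < q) (hspn : (n : ℝ) ≤ s * p) :
    ∃ u : EuclideanSpace ℝ (Fin n) → ℝ, Continuous u ∧ MemHomFrac n s p q u ∧
      ∀ γ : ℝ → EuclideanSpace ℝ (Fin n), ContinuousOn γ (Set.Ici 0) → γ 0 = 0 →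
        Filter.Tendsto (fun t => ‖γ t‖) Filter.atTop Filter.atTop →
        Filter.Tendsto (fun t => u (γ t)) Filter.atTop Filter.atTop := by
  have : NeZero n := ⟨by omega⟩
  have hp1 : 1 < p := by
    have : (2 : ℝ) ≤ n := by exact_mod_cast hn
    nlinarith
  refine ⟨logLog n, continuous_logLog n, ⟨(continuous_logLog n).measurable,
    fracEnergy_logLog_lt_top n hs0 hs1 hp1 hq hspn⟩, fun γ _ _ hγ => ?_⟩
  exact Real.tendsto_log_atTop.comp (Real.tendsto_log_atTop.comp
    (tendsto_atTop_add_const_left _ _ hγ))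

end
end

section
/- Let n ≥ 2, 0 < s < 1, 0 < p < ∞ with sp = 1, and let q satisfy 1 ≤ q < np/(n−sp). Then there exists a bounded continuous function u ∈ Ẇ^{s,p}_q(ℝ^n) such that there is no continuous curve γ : [0,∞) → ℝ^n with γ(0) = 0 and |γ(t)| → ∞ as t → ∞ for which the limit lim_{t→∞} u(γ(t)) exists. -/
open MeasureTheory Filter Set
open scoped ENNReal NNReal

noncomputable section

theorem ENNReal.rpow_neg_le_rpow_neg {a b : ℝ≥0∞} {r : ℝ} (hr : 0 ≤ r) (h : a ≤ b) :
    b ^ (-r) ≤ a ^ (-r) := by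
  rw [ENNReal.rpow_neg, ENNReal.rpow_neg, ENNReal.inv_le_inv]
  exact ENNReal.rpow_le_rpow h hr

theorem ENNReal.rpow_finsetSum_le {ι : Type*} (S : Finset ι) (a : ι → ℝ≥0∞) {r : ℝ} (hr : 0 < r) :
    (∑ i ∈ S, a i) ^ r ≤ (S.card : ℝ≥0∞) ^ r * ∑ i ∈ S, a i ^ r := by
  have h : ∑ i ∈ S, a i ≤ S.card * (∑ i ∈ S, a i ^ r) ^ (1 / r) := by
    calc ∑ i ∈ S, a i ≤ ∑ i ∈ S, (∑ j ∈ S, a j ^ r) ^ (1 / r) := by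
          refine Finset.sum_le_sum fun i hi => ?_
          rw [one_div, ENNReal.le_rpow_inv_iff hr]
          exact Finset.single_le_sum (f := fun j => a j ^ r) (fun _ _ => zero_le) hi
      _ = _ := by rw [Finset.sum_const, nsmul_eq_mul]
  calc _ ≤ (S.card * (∑ i ∈ S, a i ^ r) ^ (1 / r)) ^ r := by gcongr
    _ = _ := by
      rw [ENNReal.mul_rpow_of_nonneg _ _ hr.le, ← ENNReal.rpow_mul, one_div_mul_cancel hr.ne',
        ENNReal.rpow_one]

theorem ENNReal.rpow_add_le_two {a b : ℝ≥0∞} {r : ℝ} (hr : 0 < r) :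
    (a + b) ^ r ≤ 2 ^ r * (a ^ r + b ^ r) := by
  have := ENNReal.rpow_finsetSum_le Finset.univ ![a, b] hr
  simpa [Fin.sum_univ_two] using this

theorem ENNReal.rpow_tsum_le (a : ℕ → ℝ≥0∞) {r : ℝ} (hr : 0 < r) :
    (∑' k, a k) ^ r ≤ 2 ^ r * ∑' k, ((2 : ℝ≥0∞) ^ k) ^ r * a k ^ r := by
  have h : ∑' k, a k ≤ 2 * (∑' k, ((2 : ℝ≥0∞) ^ k) ^ r * a k ^ r) ^ (1 / r) := by
    calc ∑' k, a k
        ≤ ∑' k, (2⁻¹ : ℝ≥0∞) ^ k * (∑' k, ((2 : ℝ≥0∞) ^ k) ^ r * a k ^ r) ^ (1 / r) := by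
          refine ENNReal.tsum_le_tsum fun i => ?_
          have h2 : (2 : ℝ≥0∞) ^ i * a i ≤ (∑' k, ((2 : ℝ≥0∞) ^ k) ^ r * a k ^ r) ^ (1 / r) := by
            rw [one_div, ENNReal.le_rpow_inv_iff hr, ENNReal.mul_rpow_of_nonneg _ _ hr.le]
            exact ENNReal.le_tsum (f := fun k => ((2 : ℝ≥0∞) ^ k) ^ r * a k ^ r) i
          calc a i = (2⁻¹ : ℝ≥0∞) ^ i * (2 ^ i * a i) := by
                rw [← mul_assoc, ← mul_pow, ENNReal.inv_mul_cancel (by simp) (by simp), one_pow,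
                  one_mul]
            _ ≤ _ := by gcongr
      _ = _ := by
        rw [ENNReal.tsum_mul_right, ENNReal.tsum_geometric, ENNReal.one_sub_inv_two, inv_inv]
  calc _ ≤ (2 * (∑' k, ((2 : ℝ≥0∞) ^ k) ^ r * a k ^ r) ^ (1 / r)) ^ r := by gcongr
    _ = _ := by
      rw [ENNReal.mul_rpow_of_nonneg _ _ hr.le, ← ENNReal.rpow_mul, one_div_mul_cancel hr.ne',
        ENNReal.rpow_one]

/-- Integrals on `ℝ` scale linearly. -/
theorem lintegral_comp_mul_left_real (h : ℝ → ℝ≥0∞) {t : ℝ} (ht : t ≠ 0) :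
    ∫⁻ σ, h σ = ‖t‖ₑ * ∫⁻ σ, h (t * σ) := by
  have e : (fun x => t * x) = Homeomorph.mulLeft₀ t ht := rfl
  conv_lhs => rw [← Real.smul_map_volume_mul_left ht]
  rw [lintegral_smul_measure, e, (Homeomorph.mulLeft₀ t ht).measurableEmbedding.lintegral_map]
  simp [Real.enorm_eq_ofReal_abs]

theorem log_kernel_lintegral_lt_top {q r : ℝ} (hq : 1 ≤ q) (hr : 0 < r) (hrq : r < q) :
    ∫⁻ σ : ℝ, ‖Real.log σ‖ₑ ^ q * ‖1 - σ‖ₑ ^ (-(1 + r)) < ∞ := by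
  set h : ℝ → ℝ≥0∞ := fun σ => ‖Real.log σ‖ₑ ^ q * ‖1 - σ‖ₑ ^ (-(1 + r)) with hh
  have hq0 : 0 < q := by linarith
  have enn : ∀ {a b : ℝ} {A B : ℝ}, 0 ≤ A → 0 < b → |a| ^ q * b ^ (-(1 + r)) ≤ A * B →
      0 ≤ B → ∀ {c : ℝ}, |c| = b →
      ‖a‖ₑ ^ q * ‖c‖ₑ ^ (-(1 + r)) ≤ ENNReal.ofReal (A * B) := by
    intro a b A B hA hb hab hB c hc
    rw [Real.enorm_eq_ofReal_abs, Real.enorm_eq_ofReal_abs, hc,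
      ENNReal.ofReal_rpow_of_nonneg (abs_nonneg _) hq0.le, ENNReal.ofReal_rpow_of_pos hb,
      ← ENNReal.ofReal_mul (by positivity)]
    exact ENNReal.ofReal_le_ofReal hab
  -- near the origin
  have h1 : ∫⁻ σ in Ioc 0 (1/2), h σ < ∞ := by
    have hi : IntegrableOn (fun σ : ℝ => ((2 * q) ^ q * 2 ^ (1 + r)) * σ ^ (-(1/2) : ℝ))
        (Ioc 0 (1/2)) := by
      refine Integrable.const_mul ?_ _
      have := intervalIntegral.intervalIntegrable_rpow' (a := 0) (b := 1/2)
        (r := (-(1/2) : ℝ)) (by norm_num)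
      rwa [intervalIntegrable_iff_integrableOn_Ioc_of_le (by norm_num)] at this
    refine lt_of_le_of_lt (setLIntegral_mono_ae' measurableSet_Ioc (ae_of_all _ ?_))
      hi.lintegral_lt_top
    intro σ hσ
    refine enn (by positivity) (b := 1 - σ) (by linarith [hσ.2]) ?_
      (Real.rpow_nonneg hσ.1.le _) (abs_of_pos (by linarith [hσ.2]))
    have hlog : |Real.log σ| ≤ (2 * q) * σ ^ (-(1 / (2 * q))) := by
      rw [abs_of_nonpos (Real.log_nonpos hσ.1.le (by linarith [hσ.2])), ← Real.log_inv]
      refine (Real.log_le_rpow_div (inv_nonneg.2 hσ.1.le)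
        (show 0 < 1 / (2 * q) by positivity)).trans (le_of_eq ?_)
      rw [Real.inv_rpow hσ.1.le, Real.rpow_neg hσ.1.le]
      field_simp
    have e1 : |Real.log σ| ^ q ≤ (2 * q) ^ q * σ ^ (-(1/2) : ℝ) := by
      calc _ ≤ ((2 * q) * σ ^ (-(1 / (2 * q)))) ^ q := by gcongr
        _ = _ := by
          rw [Real.mul_rpow (by positivity) (Real.rpow_nonneg hσ.1.le _), ← Real.rpow_mul hσ.1.le]
          congr 2; field_simp
    have e2 : (1 - σ) ^ (-(1 + r)) ≤ 2 ^ (1 + r) := by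
      have : (1 - σ) ^ (-(1 + r)) ≤ (1 / 2 : ℝ) ^ (-(1 + r)) :=
        Real.rpow_le_rpow_of_nonpos (by norm_num) (by linarith [hσ.2]) (by linarith)
      rwa [one_div, Real.inv_rpow (by norm_num), Real.rpow_neg (x := 2) (by norm_num),
        inv_inv] at this
    have hσ0 : 0 < σ := hσ.1
    have e3 : 0 ≤ (1 - σ) ^ (-(1 + r)) := Real.rpow_nonneg (by linarith [hσ.2]) _
    calc _ ≤ ((2 * q) ^ q * σ ^ (-(1/2) : ℝ)) * 2 ^ (1 + r) := by gcongr
      _ = _ := by ring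
  have h2 : ∫⁻ σ in Ioc (1/2) 2, h σ < ∞ := by
    have hi : IntegrableOn (fun σ : ℝ => (2 : ℝ) ^ q * |σ - 1| ^ (q - 1 - r)) (Ioc (1/2) 2) := by
      refine Integrable.const_mul ?_ _
      have key : IntervalIntegrable (fun x : ℝ => |x| ^ (q - 1 - r)) volume (-1/2) 1 := by
        have a1 := (intervalIntegral.intervalIntegrable_rpow' (a := 0) (b := 1)
          (r := q - 1 - r) (by linarith))
        have a2 := (intervalIntegral.intervalIntegrable_rpow' (a := 0) (b := 1/2)
          (r := q - 1 - r) (by linarith))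
        refine IntervalIntegrable.trans (b := 0) ?_ ?_
        · have a3 : IntervalIntegrable (fun x : ℝ => |x| ^ (q - 1 - r)) volume 0 (1/2) := by
            refine a2.congr ?_
            intro x hx
            rw [uIoc_of_le (by norm_num)] at hx
            simp [abs_of_pos hx.1]
          have a4 := ((IntervalIntegrable.iff_comp_neg).1 a3).symm
          simpa [neg_div] using a4
        · refine a1.congr ?_
          intro x hx
          rw [uIoc_of_le (by norm_num)] at hx
          simp [abs_of_pos hx.1]
      have key2 := key.comp_sub_right 1
      rw [intervalIntegrable_iff_integrableOn_Ioc_of_le (by norm_num)] at key2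
      norm_num at key2
      simpa [IntegrableOn] using key2
    refine lt_of_le_of_lt (lintegral_mono_ae ?_) hi.lintegral_lt_top
    have hne : ∀ᵐ σ : ℝ ∂(volume.restrict (Ioc (1/2) 2)), σ ≠ 1 :=
      ae_restrict_of_ae (Measure.ae_ne volume 1)
    filter_upwards [hne, ae_restrict_mem measurableSet_Ioc] with σ hσ1 hσ
    refine enn (by positivity) (b := |σ - 1|) (abs_pos.2 (sub_ne_zero.2 hσ1)) ?_
      (by positivity) (abs_sub_comm _ _)
    have hσ0 : 0 < σ := by linarith [hσ.1]
    have hlog : |Real.log σ| ≤ 2 * |σ - 1| := by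
      rw [abs_le]
      constructor
      · have := Real.one_sub_inv_le_log_of_pos hσ0
        have h3 : σ⁻¹ * σ = 1 := inv_mul_cancel₀ hσ0.ne'
        have h4 : σ⁻¹ ≤ 2 := by
          rw [inv_le_comm₀ hσ0 (by norm_num)]; linarith [hσ.1]
        have h5 : 0 < σ⁻¹ := by positivity
        rcases le_total σ 1 with h6 | h6
        · rw [abs_of_nonpos (by linarith)]; nlinarith
        · rw [abs_of_nonneg (by linarith)]
          have := Real.log_nonneg h6
          linarith
      · have := Real.log_le_sub_one_of_pos hσ0
        have := le_abs_self (σ - 1)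
        have := abs_nonneg (σ - 1)
        linarith
    have hp : 0 < |σ - 1| := abs_pos.2 (sub_ne_zero.2 hσ1)
    calc _ ≤ (2 * |σ - 1|) ^ q * |σ - 1| ^ (-(1 + r)) := by gcongr
      _ = _ := by
        rw [Real.mul_rpow (by norm_num) hp.le, mul_assoc, ← Real.rpow_add hp]
        congr 2; ring
  have h3 : ∫⁻ σ in Ioi 2, h σ < ∞ := by
    have hi : IntegrableOn (fun σ : ℝ => ((2 * q / r) ^ q * 2 ^ (1 + r)) * σ ^ (-1 - r / 2))
        (Ioi 2) := by
      refine Integrable.const_mul ?_ _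
      exact integrableOn_Ioi_rpow_of_lt (by linarith) (by norm_num)
    refine lt_of_le_of_lt (setLIntegral_mono_ae' measurableSet_Ioi (ae_of_all _ ?_))
      hi.lintegral_lt_top
    intro σ hσ
    have hσ' : 2 < σ := hσ
    have hσ0 : 0 < σ := by linarith
    refine enn (by positivity) (b := σ - 1) (by linarith) ?_
      (by positivity) (by rw [abs_sub_comm]; exact abs_of_pos (by linarith))
    have hlog : |Real.log σ| ≤ (2 * q / r) * σ ^ (r / (2 * q)) := by
      rw [abs_of_nonneg (Real.log_nonneg (by linarith))]
      refine (Real.log_le_rpow_div hσ0.le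
        (show 0 < r / (2 * q) by positivity)).trans (le_of_eq ?_)
      field_simp
    have e1 : |Real.log σ| ^ q ≤ (2 * q / r) ^ q * σ ^ (r / 2) := by
      calc _ ≤ ((2 * q / r) * σ ^ (r / (2 * q))) ^ q := by gcongr
        _ = _ := by
          rw [Real.mul_rpow (by positivity) (by positivity), ← Real.rpow_mul hσ0.le]
          congr 2; field_simp
    have e2 : (σ - 1) ^ (-(1 + r)) ≤ 2 ^ (1 + r) * σ ^ (-(1 + r)) := by
      have : (σ - 1) ^ (-(1 + r)) ≤ (2⁻¹ * σ) ^ (-(1 + r)) :=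
        Real.rpow_le_rpow_of_nonpos (by positivity) (by linarith) (by linarith)
      rwa [Real.mul_rpow (by norm_num) hσ0.le, Real.inv_rpow (by norm_num),
        Real.rpow_neg (x := 2) (by norm_num),
        inv_inv] at this
    have e3 : 0 ≤ (σ - 1) ^ (-(1 + r)) := Real.rpow_nonneg (by linarith) _
    calc _ ≤ ((2 * q / r) ^ q * σ ^ (r / 2)) * (2 ^ (1 + r) * σ ^ (-(1 + r))) := by gcongr
      _ = ((2 * q / r) ^ q * 2 ^ (1 + r)) * (σ ^ (r / 2) * σ ^ (-(1 + r))) := by ring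
      _ = _ := by
        rw [← Real.rpow_add hσ0]
        congr 2; ring
  have hpos : ∫⁻ σ in Ioi 0, h σ < ∞ := by
    have : Ioi (0:ℝ) ⊆ Ioc 0 (1/2) ∪ (Ioc (1/2) 2 ∪ Ioi 2) := by
      intro x hx
      rcases le_or_gt x (1/2) with h | h
      · exact Or.inl ⟨hx, h⟩
      rcases le_or_gt x 2 with h' | h'
      · exact Or.inr (Or.inl ⟨h, h'⟩)
      · exact Or.inr (Or.inr h')
    refine (lintegral_mono_set this).trans_lt ((lintegral_union_le _ _ _).trans_lt ?_)
    refine ENNReal.add_lt_top.2 ⟨h1, (lintegral_union_le _ _ _).trans_lt ?_⟩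
    exact ENNReal.add_lt_top.2 ⟨h2, h3⟩
  have hneg : ∫⁻ σ in Iio 0, h σ ≤ ∫⁻ σ in Ioi 0, h σ := by
    have e : ∫⁻ σ in Iio 0, h σ = ∫⁻ σ in Ioi 0, h (-σ) := by
      have := (Measure.measurePreserving_neg (volume : Measure ℝ)).setLIntegral_comp_preimage_emb
        (MeasurableEquiv.neg ℝ).measurableEmbedding h (Iio 0)
      rw [← this]
      simp
    rw [e]
    refine setLIntegral_mono_ae' measurableSet_Ioi (ae_of_all _ fun σ hσ => ?_)
    simp only [hh, Real.log_neg_eq_log]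
    gcongr _ * ?_
    refine ENNReal.rpow_neg_le_rpow_neg (by linarith) ?_
    rw [Real.enorm_eq_ofReal_abs, Real.enorm_eq_ofReal_abs]
    refine ENNReal.ofReal_le_ofReal ?_
    have : 0 < σ := hσ
    rw [abs_of_pos (show 0 < 1 - -σ by linarith), abs_le]
    constructor <;> linarith
  have huniv : (∫⁻ σ, h σ) = (∫⁻ σ in Iio 0, h σ) + ∫⁻ σ in Ioi 0, h σ := by
    rw [← lintegral_add_compl h (measurableSet_Iio (a := (0:ℝ))), compl_Iio,
      setLIntegral_congr Ioi_ae_eq_Ici]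
  rw [huniv]
  exact ENNReal.add_lt_top.2 ⟨hneg.trans_lt hpos, hpos⟩

theorem log_sub_log_kernel_lintegral {q r : ℝ} {t : ℝ} (ht : t ≠ 0) :
    ∫⁻ τ : ℝ, ‖Real.log t - Real.log τ‖ₑ ^ q * ‖t - τ‖ₑ ^ (-(1 + r)) =
      ‖t‖ₑ ^ (-r) * ∫⁻ σ : ℝ, ‖Real.log σ‖ₑ ^ q * ‖1 - σ‖ₑ ^ (-(1 + r)) := by
  have ht0 : ‖t‖ₑ ≠ 0 := by simpa using ht
  rw [lintegral_comp_mul_left_real _ ht]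
  have h : ∀ᵐ σ : ℝ, ‖Real.log t - Real.log (t * σ)‖ₑ ^ q * ‖t - t * σ‖ₑ ^ (-(1 + r)) =
      ‖t‖ₑ ^ (-(1 + r)) * (‖Real.log σ‖ₑ ^ q * ‖1 - σ‖ₑ ^ (-(1 + r))) := by
    filter_upwards [Measure.ae_ne volume 0] with σ hσ
    rw [Real.log_mul ht hσ, sub_add_cancel_left, enorm_neg,
      show t - t * σ = t * (1 - σ) by ring, enorm_mul,
      ENNReal.mul_rpow_of_ne_top enorm_ne_top enorm_ne_top]
    ring
  rw [lintegral_congr_ae h, lintegral_const_mul' _ _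
    (ENNReal.rpow_ne_top_of_ne_zero ht0 enorm_ne_top), ← mul_assoc]
  congr 1
  conv_lhs => rw [← ENNReal.rpow_one ‖t‖ₑ, ← ENNReal.rpow_mul, one_mul]
  rw [← ENNReal.rpow_add _ _ ht0 enorm_ne_top]
  congr 1; ring

/-- The logarithmic cutoff: equal to `1` on `[-ε, ε]` and to `0` outside `(-ρ, ρ)`. -/
def logCutoff (ρ ε t : ℝ) : ℝ :=
  max 0 ((Real.log ρ - Real.log (max |t| ε)) / (Real.log ρ - Real.log ε))

section logCutoff

variable {ρ ε : ℝ}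

theorem continuous_logCutoff (hε : 0 < ε) : Continuous (logCutoff ρ ε) := by
  unfold logCutoff
  have : Continuous fun t : ℝ => Real.log (max |t| ε) :=
    (by fun_prop : Continuous fun t : ℝ => max |t| ε).log fun t =>
      (hε.trans_le (le_max_right _ _)).ne'
  fun_prop

theorem logCutoff_nonneg (t : ℝ) : 0 ≤ logCutoff ρ ε t := le_max_left _ _

theorem logCutoff_le_one (hε : 0 < ε) (h : ε < ρ) (t : ℝ) : logCutoff ρ ε t ≤ 1 := by
  have := Real.log_lt_log hε h
  have := Real.log_le_log hε (le_max_right |t| ε)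
  refine max_le zero_le_one ?_
  rw [div_le_one (by linarith)]
  linarith

theorem logCutoff_zero (hε : 0 < ε) (h : ε < ρ) : logCutoff ρ ε 0 = 1 := by
  have := Real.log_lt_log hε h
  rw [logCutoff, abs_zero, max_eq_right hε.le, div_self (by linarith)]
  simp

theorem logCutoff_eq_zero (hε : 0 < ε) (h : ε < ρ) {t : ℝ} (ht : ρ ≤ |t|) :
    logCutoff ρ ε t = 0 := by
  have h1 := Real.log_lt_log hε h
  have h2 := Real.log_le_log (hε.trans h) (ht.trans (le_max_left |t| ε))
  exact max_eq_left (div_nonpos_of_nonpos_of_nonneg (by linarith) (by linarith))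

theorem abs_logCutoff_sub_le (hε : 0 < ε) (h : ε < ρ) (t τ : ℝ) :
    |logCutoff ρ ε t - logCutoff ρ ε τ| ≤
      (Real.log ρ - Real.log ε)⁻¹ * |Real.log (max |t| ε) - Real.log (max |τ| ε)| := by
  have h1 := Real.log_lt_log hε h
  calc |logCutoff ρ ε t - logCutoff ρ ε τ|
      ≤ |(Real.log ρ - Real.log (max |t| ε)) / (Real.log ρ - Real.log ε) -
          (Real.log ρ - Real.log (max |τ| ε)) / (Real.log ρ - Real.log ε)| := by
        rw [logCutoff, logCutoff, max_comm 0, max_comm 0]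
        exact abs_max_sub_max_le_abs _ _ _
    _ = _ := by
        rw [← sub_div, abs_div, abs_of_pos (show 0 < Real.log ρ - Real.log ε by linarith),
          sub_sub_sub_cancel_left, abs_sub_comm, inv_mul_eq_div]

/-- Truncation at a level `ε ≤ |t|` only decreases differences of logarithms. -/
theorem abs_log_max_sub_le (hε : 0 < ε) {t τ : ℝ} (ht : ε ≤ |t|) (hτ : τ ≠ 0) :
    |Real.log (max |t| ε) - Real.log (max |τ| ε)| ≤ |Real.log t - Real.log τ| := by
  rw [max_eq_left ht, ← Real.log_abs t, ← Real.log_abs τ]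
  rcases le_total ε |τ| with h | h
  · rw [max_eq_left h]
  · have h1 := Real.log_le_log (abs_pos.2 hτ) h
    have h2 := Real.log_le_log hε ht
    rw [max_eq_right h, abs_of_nonneg (sub_nonneg.2 h2), abs_of_nonneg (sub_nonneg.2 (h1.trans h2))]
    linarith

theorem logCutoff_kernel_lintegral_le {q r : ℝ} (hq : 0 < q) (hr : 0 < r) (hε : 0 < ε)
    (h : ε < ρ) (t : ℝ) :
    ∫⁻ τ : ℝ, ‖logCutoff ρ ε t - logCutoff ρ ε τ‖ₑ ^ q * ‖t - τ‖ₑ ^ (-(1 + r)) ≤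
      ‖(Real.log ρ - Real.log ε)⁻¹‖ₑ ^ q *
        (2 * ∫⁻ σ : ℝ, ‖Real.log σ‖ₑ ^ q * ‖1 - σ‖ₑ ^ (-(1 + r))) *
        ‖max |t| ε‖ₑ ^ (-r) := by
  set L := Real.log ρ - Real.log ε with hL
  have hL0 : 0 < L := by have := Real.log_lt_log hε h; linarith
  set K := ∫⁻ σ : ℝ, ‖Real.log σ‖ₑ ^ q * ‖1 - σ‖ₑ ^ (-(1 + r)) with hK
  have hLtop : ‖L⁻¹‖ₑ ^ q ≠ ∞ := ENNReal.rpow_ne_top_of_nonneg hq.le enorm_ne_top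
  have hdiff : ∀ a b c : ℝ, |Real.log (max |t| ε) - Real.log (max |a| ε)| ≤
      |Real.log b - Real.log c| →
      ‖logCutoff ρ ε t - logCutoff ρ ε a‖ₑ ^ q ≤
        ‖L⁻¹‖ₑ ^ q * ‖Real.log b - Real.log c‖ₑ ^ q := by
    intro a b c hab
    rw [← ENNReal.mul_rpow_of_nonneg _ _ hq.le, ← enorm_mul]
    refine ENNReal.rpow_le_rpow ?_ hq.le
    rw [enorm_le_iff_norm_le, Real.norm_eq_abs, Real.norm_eq_abs, abs_mul,
      abs_of_pos (inv_pos.2 hL0)]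
    exact (abs_logCutoff_sub_le hε h t a).trans (by gcongr)
  rcases le_total ε |t| with ht | ht
  · have ht0 : t ≠ 0 := abs_pos.1 (hε.trans_le ht)
    calc _ ≤ ∫⁻ τ : ℝ, ‖L⁻¹‖ₑ ^ q *
          (‖Real.log t - Real.log τ‖ₑ ^ q * ‖t - τ‖ₑ ^ (-(1 + r))) := by
          refine lintegral_mono_ae ?_
          filter_upwards [Measure.ae_ne volume 0] with τ hτ
          rw [← mul_assoc]
          gcongr
          exact hdiff τ t τ (abs_log_max_sub_le hε ht hτ)
      _ = ‖L⁻¹‖ₑ ^ q * K * ‖t‖ₑ ^ (-r) := by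
          rw [lintegral_const_mul' _ _ hLtop, log_sub_log_kernel_lintegral ht0, ← hK]
          ring
      _ ≤ ‖L⁻¹‖ₑ ^ q * (2 * K) * ‖max |t| ε‖ₑ ^ (-r) := by
          rw [max_eq_left ht, Real.enorm_abs]
          gcongr
          exact le_mul_of_one_le_left zero_le one_le_two
  · have hε1 : ε ≤ |ε| := le_abs_self ε
    have hε2 : ε ≤ |-ε| := by rw [abs_neg]; exact hε1
    have hcase : ∀ c τ : ℝ, |c| = ε → τ ≠ 0 → |c - τ| ≤ |t - τ| →
        ‖logCutoff ρ ε t - logCutoff ρ ε τ‖ₑ ^ q * ‖t - τ‖ₑ ^ (-(1 + r)) ≤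
          ‖L⁻¹‖ₑ ^ q * (‖Real.log c - Real.log τ‖ₑ ^ q * ‖c - τ‖ₑ ^ (-(1 + r))) := by
      intro c τ hc hτ hle
      rw [← mul_assoc]
      refine mul_le_mul' (hdiff τ c τ ?_) (ENNReal.rpow_neg_le_rpow_neg (by linarith) ?_)
      · have := abs_log_max_sub_le hε hc.ge hτ
        rw [hc, max_self] at this
        rwa [max_eq_right ht]
      · rwa [enorm_le_iff_norm_le]
    calc _ ≤ ∫⁻ τ : ℝ, (‖L⁻¹‖ₑ ^ q *
          (‖Real.log ε - Real.log τ‖ₑ ^ q * ‖ε - τ‖ₑ ^ (-(1 + r))) + ‖L⁻¹‖ₑ ^ q *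
          (‖Real.log (-ε) - Real.log τ‖ₑ ^ q * ‖-ε - τ‖ₑ ^ (-(1 + r)))) := by
          refine lintegral_mono_ae ?_
          filter_upwards [Measure.ae_ne volume 0] with τ hτ
          rw [abs_le] at ht
          rcases le_total |τ| ε with h1 | h1
          · have : logCutoff ρ ε t = logCutoff ρ ε τ := by
              rw [logCutoff, logCutoff, max_eq_right h1, max_eq_right (abs_le.2 ht)]
            rw [this, sub_self, enorm_zero, ENNReal.zero_rpow_of_pos hq, zero_mul]
            exact zero_le
          rcases le_abs.1 h1 with h2 | h2
          · refine (hcase ε τ (abs_of_pos hε) hτ ?_).trans le_self_add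
            rw [abs_of_nonpos (by linarith), abs_of_nonpos (by linarith)]
            linarith
          · refine (hcase (-ε) τ (by rw [abs_neg, abs_of_pos hε]) hτ ?_).trans le_add_self
            rw [abs_of_nonneg (by linarith), abs_of_nonneg (by linarith)]
            linarith
      _ = _ := by
          rw [lintegral_add_left (by fun_prop), lintegral_const_mul' _ _ hLtop,
            lintegral_const_mul' _ _ hLtop, log_sub_log_kernel_lintegral hε.ne',
            log_sub_log_kernel_lintegral (neg_ne_zero.2 hε.ne'), ← hK, enorm_neg,
            max_eq_right ht]
          ring

end logCutoff

theorem setLIntegral_inv_max_abs_le {A ε : ℝ} (hε : 0 < ε) (hA : ε ≤ A) :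
    ∫⁻ t in Icc (-A) A, ‖max |t| ε‖ₑ⁻¹ ≤
      ENNReal.ofReal (2 + 2 * (Real.log A - Real.log ε)) := by
  have hA0 : 0 < A := hε.trans_le hA
  have hc : Continuous fun t : ℝ => (max |t| ε)⁻¹ :=
    (by fun_prop : Continuous fun t : ℝ => max |t| ε).inv₀ fun t =>
      (hε.trans_le (le_max_right _ _)).ne'
  have hnn : ∀ t : ℝ, 0 ≤ (max |t| ε)⁻¹ := fun t =>
    inv_nonneg.2 (hε.le.trans (le_max_right _ _))
  have e1 : ∀ t : ℝ, ‖max |t| ε‖ₑ⁻¹ = ENNReal.ofReal (max |t| ε)⁻¹ := fun t => by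
    have := hε.trans_le (le_max_right |t| ε)
    rw [Real.enorm_of_nonneg this.le, ENNReal.ofReal_inv_of_pos this]
  simp_rw [e1]
  have hpos : ∫ t in (0:ℝ)..A, (max |t| ε)⁻¹ = 1 + (Real.log A - Real.log ε) := by
    rw [← intervalIntegral.integral_add_adjacent_intervals (b := ε)
      (hc.intervalIntegrable _ _) (hc.intervalIntegrable _ _)]
    congr 1
    · rw [intervalIntegral.integral_congr (g := fun _ => ε⁻¹)]
      · simp [hε.ne']
      · intro t ht
        rw [uIcc_of_le hε.le] at ht
        simp only
        rw [abs_of_nonneg ht.1, max_eq_right ht.2]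
    · rw [intervalIntegral.integral_congr (g := fun t => t⁻¹)]
      · rw [integral_inv_of_pos hε hA0, Real.log_div hA0.ne' hε.ne']
      · intro t ht
        rw [uIcc_of_le hA] at ht
        simp only
        rw [abs_of_nonneg (hε.le.trans ht.1), max_eq_left ht.1]
  have hneg : ∫ t in (-A)..(0:ℝ), (max |t| ε)⁻¹ = ∫ t in (0:ℝ)..A, (max |t| ε)⁻¹ := by
    have := intervalIntegral.integral_comp_neg (a := 0) (b := A) fun t : ℝ => (max |t| ε)⁻¹
    simp only [abs_neg, neg_zero] at this
    exact this.symm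
  rw [setLIntegral_congr Ioc_ae_eq_Icc.symm,
    ← ofReal_integral_eq_lintegral_ofReal (hc.integrableOn_Ioc) (ae_of_all _ hnn),
    ← intervalIntegral.integral_of_le (by linarith),
    ← intervalIntegral.integral_add_adjacent_intervals (b := 0)
      (hc.intervalIntegrable _ _) (hc.intervalIntegrable _ _), hneg, hpos]
  apply le_of_eq
  congr 1
  ring

theorem exists_cutoff_small_energy {p q r : ℝ} (hp : 1 < p) (hq : 1 ≤ q) (hr : 0 < r)
    (hrq : r < q) (hrp : r * p = q) {A δ : ℝ} (hA : 1 ≤ A) (hδ : 0 < δ) :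
    ∃ f : ℝ → ℝ, Continuous f ∧ (∀ t, 0 ≤ f t) ∧ (∀ t, f t ≤ 1) ∧ f 0 = 1 ∧
      (∀ t, 1 / 2 ≤ |t| → f t = 0) ∧
      ∫⁻ t in Icc (-A) A, (∫⁻ τ : ℝ, ‖f t - f τ‖ₑ ^ q * ‖t - τ‖ₑ ^ (-(1 + r))) ^ (p / q) ≤
        ENNReal.ofReal δ ∧
      ∫⁻ t, ‖f t‖ₑ ≤ ENNReal.ofReal δ := by
  set K := ∫⁻ σ : ℝ, ‖Real.log σ‖ₑ ^ q * ‖1 - σ‖ₑ ^ (-(1 + r)) with hK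
  have hKtop : K < ∞ := log_kernel_lintegral_lt_top hq hr hrq
  have hq0 : 0 < q := by linarith
  have hp0 : 0 < p := by linarith
  set ρ : ℝ := min (1 / 2) (δ / 2) with hρ
  have hρ0 : 0 < ρ := by positivity
  have hρ1 : ρ ≤ 1 / 2 := min_le_left _ _
  have hρ2 : ρ ≤ δ / 2 := min_le_right _ _
  set c := Real.log A - Real.log ρ with hc
  set M : ℝ := ((2 * K) ^ (p / q)).toReal with hM
  have hM' : (2 * K) ^ (p / q) = ENNReal.ofReal M :=
    (ENNReal.ofReal_toReal (ENNReal.rpow_ne_top_of_nonneg (by positivity)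
      (ENNReal.mul_ne_top (by simp) hKtop.ne))).symm
  have hM0 : 0 ≤ M := ENNReal.toReal_nonneg
  have hlim : Tendsto (fun y : ℝ => M * ((2 + 2 * c) * y ^ (-p) + 2 * y ^ (-(p - 1))))
      atTop (nhds (M * ((2 + 2 * c) * 0 + 2 * 0))) :=
    (((tendsto_rpow_neg_atTop hp0).const_mul _).add
      ((tendsto_rpow_neg_atTop (by linarith)).const_mul _)).const_mul _
  simp only [mul_zero, add_zero] at hlim
  obtain ⟨y, hy, hy0⟩ := ((hlim.eventually_lt_const hδ).and (eventually_gt_atTop 0)).exists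
  set ε := ρ * Real.exp (-y) with hε
  have hε0 : 0 < ε := by positivity
  have hερ : ε < ρ := mul_lt_of_lt_one_right hρ0 (by simpa using hy0)
  have hlogε : Real.log ε = Real.log ρ - y := by
    rw [hε, Real.log_mul hρ0.ne' (Real.exp_pos _).ne', Real.log_exp]; ring
  refine ⟨logCutoff ρ ε, continuous_logCutoff hε0, logCutoff_nonneg,
    logCutoff_le_one hε0 hερ, logCutoff_zero hε0 hερ,
    fun t ht => logCutoff_eq_zero hε0 hερ (hρ1.trans ht), ?_, ?_⟩
  · have key : ∀ t : ℝ, (∫⁻ τ : ℝ, ‖logCutoff ρ ε t - logCutoff ρ ε τ‖ₑ ^ q *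
        ‖t - τ‖ₑ ^ (-(1 + r))) ^ (p / q) ≤
        ENNReal.ofReal (M * y ^ (-p)) * ‖max |t| ε‖ₑ⁻¹ := by
      intro t
      have hm : 0 < max |t| ε := hε0.trans_le (le_max_right _ _)
      refine (ENNReal.rpow_le_rpow (logCutoff_kernel_lintegral_le hq0 hr hε0 hερ t)
        (by positivity)).trans_eq ?_
      rw [hlogε, sub_sub_cancel, ← hK, ENNReal.mul_rpow_of_nonneg _ _ (by positivity),
        ENNReal.mul_rpow_of_nonneg _ _ (by positivity), hM', ← ENNReal.rpow_mul,
        ← ENNReal.rpow_mul, mul_div_cancel₀ _ hq0.ne',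
        show -r * (p / q) = -1 by rw [← hrp]; field_simp, ENNReal.rpow_neg_one,
        Real.enorm_of_nonneg (inv_nonneg.2 hy0.le), ENNReal.ofReal_rpow_of_pos (inv_pos.2 hy0),
        Real.inv_rpow hy0.le, ← Real.rpow_neg hy0.le, mul_comm M,
        ENNReal.ofReal_mul (by positivity)]
    calc _ ≤ ∫⁻ t in Icc (-A) A, ENNReal.ofReal (M * y ^ (-p)) * ‖max |t| ε‖ₑ⁻¹ :=
          lintegral_mono key
      _ = ENNReal.ofReal (M * y ^ (-p)) * ∫⁻ t in Icc (-A) A, ‖max |t| ε‖ₑ⁻¹ :=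
          lintegral_const_mul' _ _ ENNReal.ofReal_ne_top
      _ ≤ ENNReal.ofReal (M * y ^ (-p)) *
          ENNReal.ofReal (2 + 2 * (Real.log A - Real.log ε)) := by
          gcongr
          exact setLIntegral_inv_max_abs_le hε0 (by linarith)
      _ ≤ ENNReal.ofReal δ := by
          rw [← ENNReal.ofReal_mul (by positivity)]
          refine ENNReal.ofReal_le_ofReal (le_trans (le_of_eq ?_) hy.le)
          rw [hlogε, show -(p - 1) = -p + 1 by ring, Real.rpow_add_one hy0.ne', hc]
          ring
  · calc _ ≤ ∫⁻ t : ℝ, (Ioo (-ρ) ρ).indicator (fun _ => (1 : ℝ≥0∞)) t := by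
          refine lintegral_mono fun t => ?_
          by_cases ht : |t| < ρ
          · rw [indicator_of_mem (show t ∈ Ioo (-ρ) ρ from abs_lt.1 ht),
              Real.enorm_of_nonneg (logCutoff_nonneg t)]
            exact ENNReal.ofReal_le_one.2 (logCutoff_le_one hε0 hερ t)
          · rw [logCutoff_eq_zero hε0 hερ (not_lt.1 ht), enorm_zero]
            exact zero_le
      _ = ENNReal.ofReal (2 * ρ) := by
          rw [lintegral_indicator_const measurableSet_Ioo, Real.volume_Ioo, one_mul]
          congr 1; ring
      _ ≤ _ := ENNReal.ofReal_le_ofReal (by linarith)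

theorem truncated_kernel_lintegral_lt_top {q r : ℝ} (hq : 1 ≤ q) (hr : 0 < r) (hrq : r < q) :
    ∫⁻ t : ℝ, (min 1 ‖t‖ₑ) ^ q * ‖t‖ₑ ^ (-(1 + r)) < ∞ := by
  have hq0 : 0 < q := by linarith
  set Φ : ℝ → ℝ≥0∞ := fun σ => ‖Real.log σ‖ₑ ^ q * ‖1 - σ‖ₑ ^ (-(1 + r)) with hΦ
  have hK : ∫⁻ σ, Φ σ < ∞ := log_kernel_lintegral_lt_top hq hr hrq
  have hpos : ∀ t : ℝ, 0 < t → (min 1 ‖t‖ₑ) ^ q * ‖t‖ₑ ^ (-(1 + r)) ≤ 2 ^ q * Φ (1 + t) := by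
    intro t ht
    have h1 : min 1 ‖t‖ₑ ≤ 2 * ‖Real.log (1 + t)‖ₑ := by
      have h2 : min 1 t ≤ 2 * Real.log (1 + t) := by
        have := Real.one_sub_inv_le_log_of_pos (show 0 < 1 + t by linarith)
        have h3 : 1 - (1 + t)⁻¹ = t / (1 + t) := by field_simp; ring
        have h4 : min 1 t ≤ 2 * (t / (1 + t)) := by
          rw [← mul_div_assoc, le_div_iff₀ (by linarith)]
          rcases le_total 1 t with h | h
          · rw [min_eq_left h]; linarith
          · rw [min_eq_right h]; nlinarith
        linarith
      have h5 := Real.log_nonneg (show 1 ≤ 1 + t by linarith)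
      rw [Real.enorm_of_nonneg ht.le, Real.enorm_of_nonneg h5, ← ENNReal.ofReal_one,
        ← ENNReal.ofReal_min, ← ENNReal.ofReal_ofNat, ← ENNReal.ofReal_mul (by norm_num)]
      exact ENNReal.ofReal_le_ofReal h2
    rw [hΦ]
    simp only [sub_add_cancel_left, enorm_neg]
    rw [← mul_assoc, ← ENNReal.mul_rpow_of_nonneg _ _ hq0.le]
    gcongr
  have hall : ∀ t : ℝ, (min 1 ‖t‖ₑ) ^ q * ‖t‖ₑ ^ (-(1 + r)) ≤
      2 ^ q * (Φ (1 + t) + Φ (1 - t)) := by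
    intro t
    rw [mul_add]
    rcases lt_trichotomy t 0 with h | h | h
    · have := hpos (-t) (by linarith)
      rw [enorm_neg] at this
      exact this.trans le_add_self
    · simp [h, ENNReal.zero_rpow_of_pos hq0]
    · exact (hpos t h).trans le_self_add
  refine (lintegral_mono hall).trans_lt ?_
  have hm : Measurable Φ := by fun_prop
  rw [lintegral_const_mul _ (by fun_prop), lintegral_add_left (by fun_prop),
    lintegral_add_left_eq_self Φ, lintegral_sub_left_eq_self Φ]
  exact ENNReal.mul_lt_top (ENNReal.rpow_lt_top_of_nonneg hq0.le (by simp))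
    (ENNReal.add_lt_top.2 ⟨hK, hK⟩)

theorem lintegral_euclidean_eq_insertNth {m : ℕ} (i : Fin (m + 1))
    {Φ : EuclideanSpace ℝ (Fin (m + 1)) → ℝ≥0∞} (hΦ : Measurable Φ) :
    ∫⁻ y, Φ y = ∫⁻ τ : ℝ, ∫⁻ z : Fin m → ℝ, Φ (WithLp.toLp 2 (i.insertNth τ z)) := by
  have e1 : ∫⁻ y, Φ y = ∫⁻ w : Fin (m + 1) → ℝ, Φ (WithLp.toLp 2 w) :=
    ((EuclideanSpace.volume_preserving_symm_measurableEquiv_toLp (Fin (m + 1))).symm.lintegral_comp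
      hΦ).symm
  have hΦ' : Measurable fun w : Fin (m + 1) → ℝ => Φ (WithLp.toLp 2 w) :=
    hΦ.comp (MeasurableEquiv.toLp 2 (Fin (m + 1) → ℝ)).measurable
  have hmp := (volume_preserving_piFinSuccAbove (fun _ : Fin (m + 1) => ℝ) i).symm
  have hm : Measurable fun a : ℝ × (Fin m → ℝ) => Φ (WithLp.toLp 2
      ((MeasurableEquiv.piFinSuccAbove (fun _ : Fin (m + 1) => ℝ) i).symm a)) :=
    hΦ'.comp (MeasurableEquiv.measurable _)
  rw [e1, ← hmp.lintegral_comp hΦ', Measure.volume_eq_prod, lintegral_prod _ hm.aemeasurable]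
  rfl

theorem sup_kernel_lintegral {m : ℕ} {r a : ℝ} (ha : a ≠ 0) :
    ∫⁻ z : Fin m → ℝ, (max ‖a‖ₑ ‖z‖ₑ) ^ (-((m + 1 : ℕ) + r)) =
      ‖a‖ₑ ^ (-(1 + r)) * ∫⁻ z : Fin m → ℝ, (max 1 ‖z‖ₑ) ^ (-((m + 1 : ℕ) + r)) := by
  have ha0 : ‖a‖ₑ ≠ 0 := by simpa using ha
  have hs : (volume : Measure (Fin m → ℝ)) =
      ‖a‖ₑ ^ (m : ℝ) • Measure.map (fun x => a • x) volume := by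
    rw [Measure.map_addHaar_smul _ ha, smul_smul, Module.finrank_fin_fun, abs_inv, abs_pow,
      ENNReal.ofReal_inv_of_pos (by positivity), ENNReal.ofReal_pow (abs_nonneg _),
      ← Real.enorm_eq_ofReal_abs, ENNReal.rpow_natCast, ENNReal.mul_inv_cancel, one_smul]
    · exact pow_ne_zero _ ha0
    · exact ENNReal.pow_ne_top enorm_ne_top
  conv_lhs => rw [hs]
  have e : (fun x : Fin m → ℝ => a • x) = Homeomorph.smulOfNeZero a ha := rfl
  rw [lintegral_smul_measure, e, (Homeomorph.smulOfNeZero a ha).measurableEmbedding.lintegral_map]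
  have h : ∀ z : Fin m → ℝ, (max ‖a‖ₑ ‖Homeomorph.smulOfNeZero a ha z‖ₑ) ^ (-((m + 1 : ℕ) + r)) =
      ‖a‖ₑ ^ (-((m + 1 : ℕ) + r)) * (max 1 ‖z‖ₑ) ^ (-((m + 1 : ℕ) + r)) := by
    intro z
    have : Homeomorph.smulOfNeZero a ha z = a • z := rfl
    rw [this, enorm_smul, ← ENNReal.mul_rpow_of_ne_top enorm_ne_top
      (max_lt ENNReal.one_lt_top enorm_lt_top).ne, mul_max, mul_one]
  simp_rw [h]
  rw [lintegral_const_mul' _ _ (ENNReal.rpow_ne_top_of_ne_zero ha0 enorm_ne_top), smul_eq_mul,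
    ← mul_assoc, ← ENNReal.rpow_add _ _ ha0 enorm_ne_top]
  congr 2
  push_cast
  ring

theorem sup_kernel_lintegral_lt_top {m : ℕ} {r : ℝ} (hr : 0 < r) :
    ∫⁻ z : Fin m → ℝ, (max 1 ‖z‖ₑ) ^ (-((m + 1 : ℕ) + r)) < ∞ := by
  have hm : (0 : ℝ) < (m + 1 : ℕ) + r := by positivity
  have hfin : (Module.finrank ℝ (Fin m → ℝ) : ℝ) < (m + 1 : ℕ) + r := by
    rw [Module.finrank_fin_fun]; push_cast; linarith
  have h := finite_integral_one_add_norm (μ := (volume : Measure (Fin m → ℝ))) hfin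
  have hle : ∀ z : Fin m → ℝ, (max 1 ‖z‖ₑ) ^ (-((m + 1 : ℕ) + r)) ≤
      (2⁻¹ : ℝ≥0∞) ^ (-((m + 1 : ℕ) + r)) *
        ENNReal.ofReal ((1 + ‖z‖) ^ (-((m + 1 : ℕ) + r))) := by
    intro z
    have hz : ENNReal.ofReal (1 + ‖z‖) = 1 + ‖z‖ₑ := by
      rw [ENNReal.ofReal_add zero_le_one (norm_nonneg _), ENNReal.ofReal_one, ofReal_norm]
    rw [← ENNReal.ofReal_rpow_of_pos (by positivity), hz,
      ← ENNReal.mul_rpow_of_ne_top (by simp) (by simp)]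
    refine ENNReal.rpow_neg_le_rpow_neg hm.le ?_
    rw [mul_comm, ← div_eq_mul_inv]
    refine ENNReal.div_le_of_le_mul ?_
    rw [mul_two]
    exact add_le_add (le_max_left _ _) (le_max_right _ _)
  refine (lintegral_mono hle).trans_lt ?_
  have h2 : (2⁻¹ : ℝ≥0∞) ^ (-((m + 1 : ℕ) + r)) ≠ ∞ :=
    ENNReal.rpow_ne_top_of_ne_zero (by simp) (by simp)
  rw [lintegral_const_mul' _ _ h2]
  exact ENNReal.mul_lt_top h2.lt_top h

theorem exists_lintegral_coord_kernel_le (n : ℕ) {r : ℝ} (hr : 0 < r) :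
    ∃ C : ℝ≥0∞, C ≠ ∞ ∧ ∀ (i : Fin n) (h : ℝ → ℝ≥0∞), Measurable h →
      ∀ x : EuclideanSpace ℝ (Fin n),
        ∫⁻ y : EuclideanSpace ℝ (Fin n), h (y i) * ‖x - y‖ₑ ^ (-(n + r)) ≤
          C * ∫⁻ τ : ℝ, h τ * ‖x i - τ‖ₑ ^ (-(1 + r)) := by
  rcases n with _ | m
  · exact ⟨0, by simp, fun i => i.elim0⟩
  refine ⟨_, (sup_kernel_lintegral_lt_top (m := m) hr).ne, fun i h hh x => ?_⟩
  rw [lintegral_euclidean_eq_insertNth i (by fun_prop)]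
  set C := ∫⁻ z : Fin m → ℝ, (max 1 ‖z‖ₑ) ^ (-((m + 1 : ℕ) + r)) with hC
  have hm : (0 : ℝ) < (m + 1 : ℕ) + r := by positivity
  have hb : ∀ᵐ τ : ℝ, ∫⁻ z : Fin m → ℝ,
      h ((WithLp.toLp 2 (i.insertNth τ z) : EuclideanSpace ℝ (Fin (m + 1))) i) *
        ‖x - WithLp.toLp 2 (i.insertNth τ z)‖ₑ ^ (-((m + 1 : ℕ) + r)) ≤
      C * (h τ * ‖x i - τ‖ₑ ^ (-(1 + r))) := by
    filter_upwards [Measure.ae_ne volume (x i)] with τ hτ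
    have hpt : ∀ z : Fin m → ℝ,
        h ((WithLp.toLp 2 (i.insertNth τ z) : EuclideanSpace ℝ (Fin (m + 1))) i) *
          ‖x - WithLp.toLp 2 (i.insertNth τ z)‖ₑ ^ (-((m + 1 : ℕ) + r)) ≤
        h τ * (max ‖x i - τ‖ₑ ‖(fun j => x (i.succAbove j)) - z‖ₑ) ^ (-((m + 1 : ℕ) + r)) := by
      intro z
      simp only [Fin.insertNth_apply_same]
      refine mul_le_mul' le_rfl (ENNReal.rpow_neg_le_rpow_neg hm.le (max_le ?_ ?_))
      · have := PiLp.norm_apply_le (x - WithLp.toLp 2 (i.insertNth τ z)) i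
        rw [enorm_le_iff_norm_le]
        simpa using this
      · rw [enorm_le_iff_norm_le, pi_norm_le_iff_of_nonneg (norm_nonneg _)]
        intro j
        have := PiLp.norm_apply_le (x - WithLp.toLp 2 (i.insertNth τ z)) (i.succAbove j)
        simpa using this
    refine (lintegral_mono hpt).trans ?_
    rw [lintegral_const_mul _ (by fun_prop), lintegral_sub_left_eq_self
      (fun z : Fin m → ℝ => (max ‖x i - τ‖ₑ ‖z‖ₑ) ^ (-((m + 1 : ℕ) + r))),
      sup_kernel_lintegral (sub_ne_zero.2 hτ.symm), ← hC]
    exact le_of_eq (by ring)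
  refine (lintegral_mono_ae hb).trans_eq ?_
  rw [lintegral_const_mul _ (by fun_prop)]

theorem exists_setLIntegral_coord_le (n : ℕ) (B : ℝ) :
    ∃ C : ℝ≥0∞, C ≠ ∞ ∧ ∀ (i : Fin n) (h : ℝ → ℝ≥0∞), Measurable h →
      ∫⁻ x in {x : EuclideanSpace ℝ (Fin n) | ‖x.ofLp‖ ≤ B}, h (x i) ≤
        C * ∫⁻ t in Icc (-B) B, h t := by
  rcases n with _ | m
  · exact ⟨0, by simp, fun i => i.elim0⟩
  refine ⟨volume (Metric.closedBall (0 : Fin m → ℝ) B), measure_closedBall_lt_top.ne,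
    fun i h hh => ?_⟩
  have hS : MeasurableSet {x : EuclideanSpace ℝ (Fin (m + 1)) | ‖x.ofLp‖ ≤ B} :=
    (isClosed_le (by fun_prop) continuous_const).measurableSet
  rw [← lintegral_indicator hS, lintegral_euclidean_eq_insertNth i
    (Measurable.indicator (by fun_prop) hS), ← lintegral_indicator measurableSet_Icc,
    ← lintegral_const_mul _ (hh.indicator measurableSet_Icc)]
  refine lintegral_mono fun τ => ?_
  have hpt : ∀ z : Fin m → ℝ, {x : EuclideanSpace ℝ (Fin (m + 1)) | ‖x.ofLp‖ ≤ B}.indicator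
      (fun x => h (x i)) (WithLp.toLp 2 (i.insertNth τ z)) ≤
      (Icc (-B) B).indicator h τ * (Metric.closedBall (0 : Fin m → ℝ) B).indicator 1 z := by
    intro z
    by_cases hx : ‖(i.insertNth τ z : Fin (m + 1) → ℝ)‖ ≤ B
    · have hB : 0 ≤ B := (norm_nonneg _).trans hx
      have h1 : τ ∈ Icc (-B) B := by
        have := (norm_le_pi_norm _ i).trans hx
        rw [Fin.insertNth_apply_same] at this
        exact abs_le.1 this
      have h2 : z ∈ Metric.closedBall (0 : Fin m → ℝ) B := by
        rw [mem_closedBall_zero_iff, pi_norm_le_iff_of_nonneg hB]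
        intro j
        have := (norm_le_pi_norm _ (i.succAbove j)).trans hx
        rwa [Fin.insertNth_apply_succAbove] at this
      rw [indicator_of_mem h1, indicator_of_mem h2,
        indicator_of_mem (show WithLp.toLp 2 (i.insertNth τ z) ∈
          {x : EuclideanSpace ℝ (Fin (m + 1)) | ‖x.ofLp‖ ≤ B} from hx)]
      simp
    · rw [indicator_of_notMem (show WithLp.toLp 2 (i.insertNth τ z) ∉
          {x : EuclideanSpace ℝ (Fin (m + 1)) | ‖x.ofLp‖ ≤ B} from hx)]
      exact zero_le
  refine (lintegral_mono hpt).trans_eq ?_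
  rw [lintegral_const_mul _ (measurable_one.indicator measurableSet_closedBall),
    lintegral_indicator_one measurableSet_closedBall, mul_comm]

/-- The inner integral of the fractional energy, with the exponent `r = s * q`. -/
def fracDensity (n : ℕ) (q r : ℝ) (u : EuclideanSpace ℝ (Fin n) → ℝ)
    (x : EuclideanSpace ℝ (Fin n)) : ℝ≥0∞ :=
  ∫⁻ y, ‖u x - u y‖ₑ ^ q * ‖x - y‖ₑ ^ (-(n + r))

theorem measurable_fracDensity {n : ℕ} {q r : ℝ} {u : EuclideanSpace ℝ (Fin n) → ℝ}
    (hu : Measurable u) : Measurable (fracDensity n q r u) := by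
  have : Measurable fun z : EuclideanSpace ℝ (Fin n) × EuclideanSpace ℝ (Fin n) =>
      ‖u z.1 - u z.2‖ₑ ^ q * ‖z.1 - z.2‖ₑ ^ (-(n + r)) := by fun_prop
  exact this.lintegral_prod_right'

theorem exists_fracDensity_le_sum (n : ℕ) {ι : Type*} [Fintype ι] (k : ι → Fin n) {q r : ℝ}
    (hq : 1 ≤ q) (hr : 0 < r) (hrq : r < q) :
    ∃ C : ℝ≥0∞, C ≠ ∞ ∧ ∀ (c : ι → ℝ) (f : ℝ → ℝ) (u : EuclideanSpace ℝ (Fin n) → ℝ),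
      Continuous f → ∀ x : EuclideanSpace ℝ (Fin n),
      (∀ y : EuclideanSpace ℝ (Fin n), ‖u x - u y‖ₑ ≤
        ∑ j, ‖f (x (k j) - c j) - f (y (k j) - c j)‖ₑ +
          (∑ j, ‖f (x (k j) - c j)‖ₑ) * ∑ i, min 1 ‖x i - y i‖ₑ) →
      fracDensity n q r u x ≤ C * ∑ j,
        ((∫⁻ τ : ℝ, ‖f (x (k j) - c j) - f τ‖ₑ ^ q * ‖x (k j) - c j - τ‖ₑ ^ (-(1 + r))) +
          ‖f (x (k j) - c j)‖ₑ ^ q) := by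
  have hq0 : 0 < q := by linarith
  obtain ⟨C, hC, hslice⟩ := exists_lintegral_coord_kernel_le n hr
  set T := ∫⁻ t : ℝ, (min 1 ‖t‖ₑ) ^ q * ‖t‖ₑ ^ (-(1 + r)) with hT
  have hTtop : T < ∞ := truncated_kernel_lintegral_lt_top hq hr hrq
  set a : ℝ≥0∞ := ((Finset.univ : Finset ι).card : ℝ≥0∞) ^ q with ha
  set b : ℝ≥0∞ := ((Finset.univ : Finset (Fin n)).card : ℝ≥0∞) ^ q with hb
  have hatop : a ≠ ∞ := (ENNReal.rpow_lt_top_of_nonneg hq0.le (by simp)).ne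
  have hbtop : b ≠ ∞ := (ENNReal.rpow_lt_top_of_nonneg hq0.le (by simp)).ne
  have h2top : (2 : ℝ≥0∞) ^ q ≠ ∞ := (ENNReal.rpow_lt_top_of_nonneg hq0.le (by simp)).ne
  refine ⟨2 ^ q * a * C * (1 + b * (n * T)), by finiteness, fun c f u hf x hu => ?_⟩
  set D : ι → ℝ≥0∞ := fun j =>
    ∫⁻ τ : ℝ, ‖f (x (k j) - c j) - f τ‖ₑ ^ q * ‖x (k j) - c j - τ‖ₑ ^ (-(1 + r)) with hD
  set S : ℝ≥0∞ := ∑ j, ‖f (x (k j) - c j)‖ₑ ^ q with hS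
  have hfm : Measurable f := hf.measurable
  have hpt : ∀ y : EuclideanSpace ℝ (Fin n), ‖u x - u y‖ₑ ^ q * ‖x - y‖ₑ ^ (-(n + r)) ≤
      2 ^ q * a * (∑ j, ‖f (x (k j) - c j) - f (y (k j) - c j)‖ₑ ^ q * ‖x - y‖ₑ ^ (-(n + r)) +
        S * b * ∑ i, (min 1 ‖x i - y i‖ₑ) ^ q * ‖x - y‖ₑ ^ (-(n + r))) := by
    intro y
    rw [← Finset.sum_mul, ← Finset.sum_mul, ← mul_assoc, ← add_mul, ← mul_assoc]
    refine mul_le_mul' ?_ le_rfl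
    calc ‖u x - u y‖ₑ ^ q ≤ _ := ENNReal.rpow_le_rpow (hu y) hq0.le
      _ ≤ _ := ENNReal.rpow_add_le_two hq0
      _ ≤ 2 ^ q * (a * ∑ j, ‖f (x (k j) - c j) - f (y (k j) - c j)‖ₑ ^ q +
          (a * S) * (b * ∑ i, (min 1 ‖x i - y i‖ₑ) ^ q)) := by
        rw [ENNReal.mul_rpow_of_nonneg _ _ hq0.le]
        gcongr
        · exact ENNReal.rpow_finsetSum_le _ _ hq0
        · exact ENNReal.rpow_finsetSum_le _ _ hq0
        · exact ENNReal.rpow_finsetSum_le _ _ hq0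
      _ = _ := by ring
  have h1 : ∀ j, ∫⁻ y : EuclideanSpace ℝ (Fin n),
      ‖f (x (k j) - c j) - f (y (k j) - c j)‖ₑ ^ q * ‖x - y‖ₑ ^ (-(n + r)) ≤ C * D j := by
    intro j
    refine (hslice (k j) (fun τ => ‖f (x (k j) - c j) - f (τ - c j)‖ₑ ^ q)
      (by fun_prop) x).trans_eq ?_
    simp only [hD]
    congr 1
    rw [← lintegral_sub_right_eq_self (fun τ : ℝ => ‖f (x (k j) - c j) - f τ‖ₑ ^ q *
      ‖x (k j) - c j - τ‖ₑ ^ (-(1 + r))) (c j)]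
    simp
  have h2 : ∀ i, ∫⁻ y : EuclideanSpace ℝ (Fin n),
      (min 1 ‖x i - y i‖ₑ) ^ q * ‖x - y‖ₑ ^ (-(n + r)) ≤ C * T := by
    intro i
    refine (hslice i (fun τ => (min 1 ‖x i - τ‖ₑ) ^ q) (by fun_prop) x).trans_eq ?_
    rw [hT, lintegral_sub_left_eq_self (fun t : ℝ => (min 1 ‖t‖ₑ) ^ q * ‖t‖ₑ ^ (-(1 + r)))]
  rw [Finset.sum_add_distrib]
  calc fracDensity n q r u x ≤ _ := lintegral_mono hpt
    _ = 2 ^ q * a * (∑ j, (∫⁻ y : EuclideanSpace ℝ (Fin n),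
          ‖f (x (k j) - c j) - f (y (k j) - c j)‖ₑ ^ q * ‖x - y‖ₑ ^ (-(n + r))) +
        S * b * ∑ i, ∫⁻ y : EuclideanSpace ℝ (Fin n),
          (min 1 ‖x i - y i‖ₑ) ^ q * ‖x - y‖ₑ ^ (-(n + r))) := by
      rw [lintegral_const_mul _ (by fun_prop), lintegral_add_left (by fun_prop),
        lintegral_finsetSum _ (by fun_prop), lintegral_const_mul _ (by fun_prop),
        lintegral_finsetSum _ (by fun_prop)]
    _ ≤ 2 ^ q * a * (∑ j, C * D j + S * b * ∑ i : Fin n, C * T) := by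
      gcongr with j _ i _
      · exact h1 j
      · exact h2 i
    _ = 2 ^ q * a * C * (∑ j, D j + b * (n * T) * S) := by
      rw [← Finset.mul_sum, Finset.sum_const, Finset.card_univ, Fintype.card_fin, nsmul_eq_mul]
      ring
    _ ≤ 2 ^ q * a * C * ((1 + b * (n * T)) * (∑ j, D j + S)) := by
      gcongr
      rw [add_mul, one_mul, mul_add]
      gcongr
      · exact le_self_add
      · exact le_add_self
    _ = _ := by ring

theorem exists_setLIntegral_fracDensity_le (n : ℕ) {ι : Type*} [Fintype ι] (k : ι → Fin n)
    {p q r B : ℝ} (hp : 1 ≤ p) (hq : 1 ≤ q) (hr : 0 < r) (hrq : r < q) :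
    ∃ C : ℝ≥0∞, C ≠ ∞ ∧ ∀ (c : ι → ℝ) (A : ℝ) (f : ℝ → ℝ) (u : EuclideanSpace ℝ (Fin n) → ℝ),
      (∀ j, B + |c j| ≤ A) → Continuous f → (∀ t, ‖f t‖ₑ ≤ 1) →
      (∀ x y : EuclideanSpace ℝ (Fin n), ‖u x - u y‖ₑ ≤
        ∑ j, ‖f (x (k j) - c j) - f (y (k j) - c j)‖ₑ +
          (∑ j, ‖f (x (k j) - c j)‖ₑ) * ∑ i, min 1 ‖x i - y i‖ₑ) →
      ∫⁻ x in {x : EuclideanSpace ℝ (Fin n) | ‖x.ofLp‖ ≤ B}, fracDensity n q r u x ^ (p / q) ≤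
        C * ((∫⁻ t in Icc (-A) A,
          (∫⁻ τ : ℝ, ‖f t - f τ‖ₑ ^ q * ‖t - τ‖ₑ ^ (-(1 + r))) ^ (p / q)) + ∫⁻ t, ‖f t‖ₑ) := by
  have hq0 : 0 < q := by linarith
  have he : 0 < p / q := by positivity
  obtain ⟨C, hC, hdens⟩ := exists_fracDensity_le_sum n k hq hr hrq
  obtain ⟨K, hK, hbox⟩ := exists_setLIntegral_coord_le n B
  set a : ℝ≥0∞ := ((Finset.univ : Finset ι).card : ℝ≥0∞) ^ (p / q) with ha
  have hatop : a ≠ ∞ := (ENNReal.rpow_lt_top_of_nonneg he.le (by simp)).ne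
  have hCtop : C ^ (p / q) ≠ ∞ := (ENNReal.rpow_lt_top_of_nonneg he.le hC).ne
  have h2top : (2 : ℝ≥0∞) ^ (p / q) ≠ ∞ := (ENNReal.rpow_lt_top_of_nonneg he.le (by simp)).ne
  refine ⟨C ^ (p / q) * a * (2 ^ (p / q)) * (Fintype.card ι * K), by finiteness,
    fun c A f u hA hf hf1 hu => ?_⟩
  have hfm : Measurable f := hf.measurable
  set G : ℝ → ℝ≥0∞ := fun t =>
    (∫⁻ τ : ℝ, ‖f t - f τ‖ₑ ^ q * ‖t - τ‖ₑ ^ (-(1 + r))) ^ (p / q) with hG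
  have hGm : Measurable G := by
    have : Measurable fun z : ℝ × ℝ => ‖f z.1 - f z.2‖ₑ ^ q * ‖z.1 - z.2‖ₑ ^ (-(1 + r)) := by
      fun_prop
    exact this.lintegral_prod_right'.pow_const _
  have hpt : ∀ x, fracDensity n q r u x ^ (p / q) ≤ C ^ (p / q) * a * 2 ^ (p / q) *
      ∑ j, (G (x (k j) - c j) + ‖f (x (k j) - c j)‖ₑ) := by
    intro x
    refine (ENNReal.rpow_le_rpow (hdens c f u hf x (hu x)) he.le).trans ?_
    rw [ENNReal.mul_rpow_of_nonneg _ _ he.le, mul_assoc, mul_assoc]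
    gcongr
    refine (ENNReal.rpow_finsetSum_le _ _ he).trans (mul_le_mul' le_rfl ?_)
    rw [Finset.mul_sum]
    refine Finset.sum_le_sum fun j _ => ?_
    refine (ENNReal.rpow_add_le_two he).trans ?_
    gcongr
    rw [← ENNReal.rpow_mul, mul_div_cancel₀ _ hq0.ne']
    calc _ ≤ ‖f (x (k j) - c j)‖ₑ ^ (1 : ℝ) := ENNReal.rpow_le_rpow_of_exponent_ge (hf1 _) hp
      _ = _ := ENNReal.rpow_one _
  have h1 : ∀ j, ∫⁻ x in {x : EuclideanSpace ℝ (Fin n) | ‖x.ofLp‖ ≤ B},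
      (G (x (k j) - c j) + ‖f (x (k j) - c j)‖ₑ) ≤
      K * ((∫⁻ t in Icc (-A) A, G t) + ∫⁻ t, ‖f t‖ₑ) := by
    intro j
    refine (hbox (k j) (fun t => G (t - c j) + ‖f (t - c j)‖ₑ) (by fun_prop)).trans ?_
    rw [lintegral_add_left (by fun_prop)]
    refine mul_le_mul' le_rfl (add_le_add ?_ ?_)
    · rw [← lintegral_indicator measurableSet_Icc, ← lintegral_indicator measurableSet_Icc,
        ← lintegral_sub_right_eq_self ((Icc (-A) A).indicator G) (c j)]
      refine lintegral_mono fun t => ?_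
      refine indicator_apply_le' (fun ht => ?_) fun _ => zero_le
      rw [indicator_of_mem]
      have := hA j
      have := abs_le.1 (le_refl |c j|)
      exact ⟨by linarith [ht.1], by linarith [ht.2]⟩
    · refine (setLIntegral_le_lintegral _ _).trans_eq ?_
      exact lintegral_sub_right_eq_self (fun t => ‖f t‖ₑ) (c j)
  calc _ ≤ _ := lintegral_mono hpt
    _ = C ^ (p / q) * a * 2 ^ (p / q) * ∑ j,
        ∫⁻ x in {x : EuclideanSpace ℝ (Fin n) | ‖x.ofLp‖ ≤ B},
          (G (x (k j) - c j) + ‖f (x (k j) - c j)‖ₑ) := by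
      rw [lintegral_const_mul _ (by fun_prop), lintegral_finsetSum _ (by fun_prop)]
    _ ≤ C ^ (p / q) * a * 2 ^ (p / q) * ∑ j : ι,
        K * ((∫⁻ t in Icc (-A) A, G t) + ∫⁻ t, ‖f t‖ₑ) := by
      gcongr with j
      exact h1 j
    _ = _ := by
      rw [Finset.sum_const, Finset.card_univ, nsmul_eq_mul]
      ring

theorem exists_norm_le_mul_norm_ofLp (n : ℕ) :
    ∃ K : ℝ≥0, ∀ x : EuclideanSpace ℝ (Fin n), ‖x‖ ≤ K * ‖x.ofLp‖ := by
  have h := PiLp.antilipschitzWith_ofLp 2 (fun _ : Fin n => ℝ)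
  exact ⟨_, fun x => by simpa only [dist_zero_right, WithLp.ofLp_zero] using h.le_mul_dist x 0⟩

theorem exists_setLIntegral_fracDensity_far_le (n : ℕ) {p q r : ℝ} (hp : 0 < p) (hq : 0 < q)
    (hr : 0 < r) (hn : (n : ℝ) < (n + r) * (p / q)) :
    ∃ C : ℝ≥0∞, C ≠ ∞ ∧ ∀ (ρ : ℝ) (u : EuclideanSpace ℝ (Fin n) → ℝ), 1 ≤ ρ → Measurable u →
      (∀ x, ρ < ‖x.ofLp‖ → u x = 0) →
      ∫⁻ x in {x : EuclideanSpace ℝ (Fin n) | ‖x.ofLp‖ ≤ 2 * ρ}ᶜ, fracDensity n q r u x ^ (p / q) ≤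
        C * (∫⁻ x, ‖u x‖ₑ ^ q) ^ (p / q) := by
  have he : 0 < p / q := by positivity
  have hnr : 0 < n + r := by positivity
  obtain ⟨K, hK⟩ := exists_norm_le_mul_norm_ofLp n
  set M : ℝ := 2 * (1 + K) with hM
  have hM0 : 0 < M := by positivity
  have hI := finite_integral_one_add_norm (μ := (volume : Measure (EuclideanSpace ℝ (Fin n))))
    (r := (n + r) * (p / q)) (by simpa using hn)
  set I := ∫⁻ x : EuclideanSpace ℝ (Fin n), ENNReal.ofReal ((1 + ‖x‖) ^ (-((n + r) * (p / q))))
    with hIdef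
  refine ⟨ENNReal.ofReal (M ^ ((n + r) * (p / q))) * I, by finiteness, fun ρ u hρ hum hu => ?_⟩
  have hpt : ∀ x : EuclideanSpace ℝ (Fin n), 2 * ρ < ‖x.ofLp‖ →
      fracDensity n q r u x ^ (p / q) ≤
      ENNReal.ofReal (M ^ ((n + r) * (p / q))) *
        ENNReal.ofReal ((1 + ‖x‖) ^ (-((n + r) * (p / q)))) * (∫⁻ x, ‖u x‖ₑ ^ q) ^ (p / q) := by
    intro x hx
    have hux : u x = 0 := hu x (by linarith)
    have h1 : fracDensity n q r u x ≤
        ENNReal.ofReal (((1 + ‖x‖) / M) ^ (-(n + r))) * ∫⁻ y, ‖u y‖ₑ ^ q := by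
      rw [← lintegral_const_mul _ (by fun_prop)]
      refine lintegral_mono fun y => ?_
      rw [hux, zero_sub, enorm_neg, mul_comm]
      by_cases hy : ρ < ‖y.ofLp‖
      · simp [hu y hy, ENNReal.zero_rpow_of_pos hq]
      refine mul_le_mul' ?_ le_rfl
      rw [← ENNReal.ofReal_rpow_of_pos (by positivity)]
      refine ENNReal.rpow_neg_le_rpow_neg hnr.le ?_
      rw [← ofReal_norm]
      refine ENNReal.ofReal_le_ofReal ?_
      rw [div_le_iff₀ hM0]
      have h2 : ‖(x - y).ofLp‖ ≤ ‖x - y‖ := by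
        rw [pi_norm_le_iff_of_nonneg (norm_nonneg _)]
        exact fun i => PiLp.norm_apply_le _ i
      have h3 : ‖x.ofLp‖ - ‖y.ofLp‖ ≤ ‖(x - y).ofLp‖ := norm_sub_norm_le _ _
      have h4 := hK x
      push Not at hy
      have h5 : ‖x.ofLp‖ ≤ 2 * ‖x - y‖ := by linarith
      have h6 : 1 + ‖x‖ ≤ (1 + K) * ‖x.ofLp‖ := by linarith
      calc _ ≤ _ := h6
        _ ≤ (1 + K) * (2 * ‖x - y‖) := by gcongr
        _ = _ := by rw [hM]; ring
    refine (ENNReal.rpow_le_rpow h1 he.le).trans_eq ?_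
    rw [ENNReal.mul_rpow_of_nonneg _ _ he.le]
    congr 1
    rw [ENNReal.ofReal_rpow_of_nonneg (by positivity) he.le, ← Real.rpow_mul (by positivity),
      ← ENNReal.ofReal_mul (by positivity), Real.div_rpow (by positivity) hM0.le,
      neg_mul, Real.rpow_neg hM0.le, div_inv_eq_mul, mul_comm]
  have hms : MeasurableSet {x : EuclideanSpace ℝ (Fin n) | ‖x.ofLp‖ ≤ 2 * ρ}ᶜ :=
    (measurableSet_le (by fun_prop) (by fun_prop)).compl
  calc _ ≤ ∫⁻ x in {x : EuclideanSpace ℝ (Fin n) | ‖x.ofLp‖ ≤ 2 * ρ}ᶜ,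
        ENNReal.ofReal (M ^ ((n + r) * (p / q))) *
        ENNReal.ofReal ((1 + ‖x‖) ^ (-((n + r) * (p / q)))) * (∫⁻ x, ‖u x‖ₑ ^ q) ^ (p / q) :=
      setLIntegral_mono' hms fun x hx => hpt x (by simpa using hx)
    _ ≤ _ := setLIntegral_le_lintegral _ _
    _ = _ := by
      rw [lintegral_mul_const _ (by fun_prop), lintegral_const_mul _ (by fun_prop)]

theorem exists_abs_apply_eq_norm_ofLp {n : ℕ} [NeZero n] (x : EuclideanSpace ℝ (Fin n)) :
    ∃ i, |x i| = ‖x.ofLp‖ := by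
  obtain ⟨i, hi⟩ := Finite.exists_max fun i => |x i|
  refine ⟨i, le_antisymm (norm_le_pi_norm x.ofLp i) ?_⟩
  exact (pi_norm_le_iff_of_nonneg (abs_nonneg _)).2 hi

theorem exists_sphere_bump {n : ℕ} [NeZero n] {p q r : ℝ} (hp : 1 < p) (hq : 1 ≤ q) (hr : 0 < r)
    (hrq : r < q) (hrp : r * p = q) (hn : (n : ℝ) < (n + r) * (p / q)) {R : ℝ} (hR : 1 ≤ R)
    {δ : ℝ≥0∞} (hδ : δ ≠ 0) :
    ∃ u : EuclideanSpace ℝ (Fin n) → ℝ, Continuous u ∧ (∀ x, 0 ≤ u x) ∧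
      (∀ x, ‖x.ofLp‖ = R → u x = 1) ∧ (∀ x, ‖x.ofLp‖ ≤ R - 1 / 2 → u x = 0) ∧
      (∀ x, R + 1 ≤ ‖x.ofLp‖ → u x = 0) ∧ ∫⁻ x, fracDensity n q r u x ^ (p / q) ≤ δ := by
  have hq0 : 0 < q := by linarith
  have he : 0 < p / q := by positivity
  obtain ⟨C₁, hC₁, hnear⟩ := exists_setLIntegral_fracDensity_le n (ι := Fin n × Bool) Prod.fst
    (B := 2 * (R + 1)) hp.le hq hr hrq
  obtain ⟨C₂, hC₂, hfar⟩ := exists_setLIntegral_fracDensity_far_le n (by linarith) hq0 hr hn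
  obtain ⟨C₃, hC₃, hbox⟩ := exists_setLIntegral_coord_le n (R + 1)
  set M : ℝ≥0∞ := Fintype.card (Fin n × Bool) * C₃ with hM
  have hMtop : M ≠ ∞ := by finiteness
  obtain ⟨ε, hεδ, hε⟩ : ∃ ε : ℝ, C₁ * (ENNReal.ofReal ε + ENNReal.ofReal ε) +
      C₂ * (M * ENNReal.ofReal ε) ^ (p / q) ≤ δ ∧ 0 < ε := by
    have hc : Continuous fun ε : ℝ => C₁ * (ENNReal.ofReal ε + ENNReal.ofReal ε) +
        C₂ * (M * ENNReal.ofReal ε) ^ (p / q) := by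
      refine ((ENNReal.continuous_const_mul hC₁).comp
        (ENNReal.continuous_ofReal.add ENNReal.continuous_ofReal)).add
        ((ENNReal.continuous_const_mul hC₂).comp (ENNReal.continuous_rpow_const.comp
          ((ENNReal.continuous_const_mul hMtop).comp ENNReal.continuous_ofReal)))
    have ht := (hc.tendsto 0).mono_left (nhdsWithin_le_nhds (s := Ioi 0))
    simp only [ENNReal.ofReal_zero, add_zero, mul_zero, ENNReal.zero_rpow_of_pos he] at ht
    exact ((ht.eventually (eventually_le_nhds (pos_iff_ne_zero.2 hδ))).and
      self_mem_nhdsWithin).exists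
  obtain ⟨f, hf, hf0, hf1, hfz, hfs, hfE, hfI⟩ := exists_cutoff_small_energy hp hq hr hrq hrp
    (A := 3 * R + 2) (by linarith) hε
  have hfm : Measurable f := hf.measurable
  set c : Fin n × Bool → ℝ := fun j => cond j.2 R (-R) with hc
  have hcabs : ∀ j, |c j| = R := by
    rintro ⟨i, _ | _⟩ <;> simp [hc, abs_of_nonneg (zero_le_one.trans hR)]
  set F : EuclideanSpace ℝ (Fin n) → ℝ := fun x => ∑ j : Fin n × Bool, f (x j.1 - c j) with hF
  set η : EuclideanSpace ℝ (Fin n) → ℝ := fun x => max 0 (min 1 (R + 1 - ‖x.ofLp‖)) with hη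
  have hFc : Continuous F := by fun_prop
  have hF0 : ∀ x, 0 ≤ F x := fun x => Finset.sum_nonneg fun j _ => hf0 _
  have hη0 : ∀ x, 0 ≤ η x := fun x => le_max_left _ _
  have hη1 : ∀ x, η x ≤ 1 := fun x => max_le zero_le_one (min_le_left _ _)
  have hηfar : ∀ x : EuclideanSpace ℝ (Fin n), R + 1 ≤ ‖x.ofLp‖ → η x = 0 := fun x hx =>
    max_eq_left ((min_le_right _ _).trans (by linarith))
  have hfe : ∀ t, ‖f t‖ₑ ≤ 1 := fun t => by
    rw [Real.enorm_of_nonneg (hf0 t)]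
    exact ENNReal.ofReal_le_one.2 (hf1 t)
  have hFe : ∀ x, ‖min 1 (F x)‖ₑ ≤ ∑ j : Fin n × Bool, ‖f (x j.1 - c j)‖ₑ := fun x => by
    refine le_trans ?_ (enorm_sum_le _ _)
    rw [Real.enorm_of_nonneg (le_min zero_le_one (hF0 x)), Real.enorm_of_nonneg (hF0 x)]
    exact ENNReal.ofReal_le_ofReal (min_le_right _ _)
  have hdiff : ∀ x y : EuclideanSpace ℝ (Fin n), ‖min 1 (F x) * η x - min 1 (F y) * η y‖ₑ ≤
      ∑ j : Fin n × Bool, ‖f (x j.1 - c j) - f (y j.1 - c j)‖ₑ +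
        (∑ j : Fin n × Bool, ‖f (x j.1 - c j)‖ₑ) * ∑ i, min 1 ‖x i - y i‖ₑ := by
    intro x y
    have h1 : ‖min 1 (F x) - min 1 (F y)‖ₑ ≤
        ∑ j : Fin n × Bool, ‖f (x j.1 - c j) - f (y j.1 - c j)‖ₑ := by
      refine le_trans ?_ (enorm_sum_le _ _)
      rw [Finset.sum_sub_distrib, enorm_le_iff_norm_le]
      simpa using abs_min_sub_min_le_max 1 (F x) 1 (F y)
    have h2 : ‖η x - η y‖ₑ ≤ ∑ i, min 1 ‖x i - y i‖ₑ := by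
      obtain ⟨i, hi⟩ := exists_abs_apply_eq_norm_ofLp (x - y)
      refine le_trans (le_min ?_ ?_) (Finset.single_le_sum (f := fun i => min 1 ‖x i - y i‖ₑ)
        (fun i _ => zero_le) (Finset.mem_univ i))
      · rw [← enorm_one (G := ℝ), enorm_le_iff_norm_le, norm_one, Real.norm_eq_abs, abs_le]
        constructor <;> linarith [hη0 x, hη0 y, hη1 x, hη1 y]
      · rw [enorm_le_iff_norm_le]
        have h3 : |η x - η y| ≤ |‖x.ofLp‖ - ‖y.ofLp‖| := by
          refine (abs_max_sub_max_le_max 0 _ 0 _).trans (max_le (by simp) ?_)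
          refine (abs_min_sub_min_le_max 1 _ 1 _).trans (max_le (by simp) ?_)
          rw [abs_sub_comm ‖x.ofLp‖]
          exact le_of_eq (by congr 1; ring)
        exact h3.trans ((abs_norm_sub_norm_le _ _).trans hi.ge)
    calc _ = ‖(min 1 (F x) - min 1 (F y)) * η y + min 1 (F x) * (η x - η y)‖ₑ := by
          congr 1; ring
      _ ≤ ‖(min 1 (F x) - min 1 (F y))‖ₑ * ‖η y‖ₑ + ‖min 1 (F x)‖ₑ * ‖η x - η y‖ₑ := by
          rw [← enorm_mul, ← enorm_mul]
          exact enorm_add_le _ _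
      _ ≤ _ := by
          refine add_le_add ((mul_le_of_le_one_right' ?_).trans h1) (mul_le_mul' (hFe x) h2)
          rw [Real.enorm_of_nonneg (hη0 y)]
          exact ENNReal.ofReal_le_one.2 (hη1 y)
  have huc : Continuous fun x => min 1 (F x) * η x := by fun_prop
  have hufar : ∀ x : EuclideanSpace ℝ (Fin n), R + 1 ≤ ‖x.ofLp‖ → min 1 (F x) * η x = 0 :=
    fun x hx => by rw [hηfar x hx, mul_zero]
  refine ⟨fun x => min 1 (F x) * η x, huc,
    fun x => mul_nonneg (le_min zero_le_one (hF0 x)) (hη0 x), fun x hx => ?_, fun x hx => ?_,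
    hufar, ?_⟩
  · obtain ⟨i, hi⟩ := exists_abs_apply_eq_norm_ofLp x
    have h1 : 1 ≤ F x := by
      obtain ⟨b, hb⟩ : ∃ b, x i - c (i, b) = 0 := by
        rcases abs_choice (x i) with h | h
        · exact ⟨true, by simp only [hc, cond_true]; linarith⟩
        · exact ⟨false, by simp only [hc, cond_false]; linarith⟩
      rw [← hfz, ← hb]
      exact Finset.single_le_sum (f := fun j : Fin n × Bool => f (x j.1 - c j))
        (fun j _ => hf0 _) (Finset.mem_univ (i, b))
    have h2 : η x = 1 := by simp [hη, hx]
    simp only [h2, min_eq_left h1, mul_one]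
  · have h1 : F x = 0 := by
      refine Finset.sum_eq_zero fun j _ => hfs _ ?_
      have h2 : |x j.1| ≤ ‖x.ofLp‖ := norm_le_pi_norm x.ofLp j.1
      have h3 := abs_sub_abs_le_abs_sub (c j) (x j.1)
      rw [abs_sub_comm, hcabs] at h3
      linarith
    simp [h1]
  · have h1 : ∫⁻ x, ‖min 1 (F x) * η x‖ₑ ^ q ≤ M * ENNReal.ofReal ε := by
      have hms : MeasurableSet {x : EuclideanSpace ℝ (Fin n) | ‖x.ofLp‖ ≤ R + 1} :=
        measurableSet_le (by fun_prop) (by fun_prop)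
      calc ∫⁻ x, ‖min 1 (F x) * η x‖ₑ ^ q
          ≤ ∫⁻ x in {x : EuclideanSpace ℝ (Fin n) | ‖x.ofLp‖ ≤ R + 1},
            ∑ j : Fin n × Bool, ‖f (x j.1 - c j)‖ₑ := by
            rw [← lintegral_indicator hms]
            refine lintegral_mono fun x => ?_
            by_cases hx : ‖x.ofLp‖ ≤ R + 1
            · rw [indicator_of_mem (by exact hx)]
              have h2 : ‖min 1 (F x) * η x‖ₑ ≤ ‖min 1 (F x)‖ₑ := by
                rw [enorm_le_iff_norm_le, norm_mul]
                refine mul_le_of_le_one_right (norm_nonneg _) ?_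
                rw [Real.norm_of_nonneg (hη0 x)]
                exact hη1 x
              have h3 : ‖min 1 (F x)‖ₑ ≤ 1 := by
                rw [Real.enorm_of_nonneg (le_min zero_le_one (hF0 x))]
                exact ENNReal.ofReal_le_one.2 (min_le_left _ _)
              calc ‖min 1 (F x) * η x‖ₑ ^ q ≤ ‖min 1 (F x) * η x‖ₑ ^ (1 : ℝ) :=
                    ENNReal.rpow_le_rpow_of_exponent_ge (h2.trans h3) hq
                _ ≤ _ := by rw [ENNReal.rpow_one]; exact h2.trans (hFe x)
            · rw [hufar x (by linarith), enorm_zero, ENNReal.zero_rpow_of_pos hq0]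
              exact zero_le
        _ = ∑ j : Fin n × Bool, ∫⁻ x in {x : EuclideanSpace ℝ (Fin n) | ‖x.ofLp‖ ≤ R + 1},
            ‖f (x j.1 - c j)‖ₑ := lintegral_finsetSum _ (by fun_prop)
        _ ≤ ∑ _j : Fin n × Bool, C₃ * ENNReal.ofReal ε := by
            refine Finset.sum_le_sum fun j _ => ?_
            refine (hbox j.1 (fun t => ‖f (t - c j)‖ₑ) (by fun_prop)).trans ?_
            refine mul_le_mul' le_rfl ((setLIntegral_le_lintegral _ _).trans ?_)
            rw [lintegral_sub_right_eq_self (fun t => ‖f t‖ₑ) (c j)]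
            exact hfI
        _ = _ := by rw [Finset.sum_const, Finset.card_univ, nsmul_eq_mul, mul_assoc]
    have hms : MeasurableSet {x : EuclideanSpace ℝ (Fin n) | ‖x.ofLp‖ ≤ 2 * (R + 1)} :=
      measurableSet_le (by fun_prop) (by fun_prop)
    rw [← lintegral_add_compl _ hms]
    refine (add_le_add ((hnear c (3 * R + 2) f _ (fun j => by rw [hcabs]; linarith) hf hfe
      hdiff).trans (mul_le_mul' le_rfl (add_le_add hfE hfI)))
      ((hfar (R + 1) _ (by linarith) huc.measurable fun x hx => hufar x hx.le).trans
        (mul_le_mul' le_rfl (ENNReal.rpow_le_rpow h1 he.le)))).trans hεδ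

theorem fracDensity_rpow_le_tsum {n : ℕ} {q r e : ℝ} (hq : 0 < q) (he : 0 < e)
    {u : EuclideanSpace ℝ (Fin n) → ℝ} {v : ℕ → EuclideanSpace ℝ (Fin n) → ℝ}
    (hv : ∀ k, Measurable (v k))
    (h : ∀ x y, ‖u x - u y‖ₑ ≤ ∑' k, ‖v k x - v k y‖ₑ) (x : EuclideanSpace ℝ (Fin n)) :
    fracDensity n q r u x ^ e ≤ (2 ^ q) ^ e * 2 ^ e *
      ∑' k : ℕ, (((2 : ℝ≥0∞) ^ k) ^ e * (((2 : ℝ≥0∞) ^ k) ^ q) ^ e) *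
        fracDensity n q r (v k) x ^ e := by
  have h1 : fracDensity n q r u x ≤
      2 ^ q * ∑' k, ((2 : ℝ≥0∞) ^ k) ^ q * fracDensity n q r (v k) x := by
    have hpt : ∀ y, ‖u x - u y‖ₑ ^ q * ‖x - y‖ₑ ^ (-(n + r)) ≤
        2 ^ q * ∑' k, ((2 : ℝ≥0∞) ^ k) ^ q * (‖v k x - v k y‖ₑ ^ q * ‖x - y‖ₑ ^ (-(n + r))) := by
      intro y
      simp_rw [← mul_assoc]
      rw [ENNReal.tsum_mul_right, ← mul_assoc]
      exact mul_le_mul' ((ENNReal.rpow_le_rpow (h x y) hq.le).trans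
        (ENNReal.rpow_tsum_le _ hq)) le_rfl
    refine (lintegral_mono hpt).trans_eq ?_
    rw [lintegral_const_mul _ (by fun_prop), lintegral_tsum (by fun_prop)]
    congr 2 with k
    rw [lintegral_const_mul _ (by fun_prop), fracDensity]
  refine (ENNReal.rpow_le_rpow h1 he.le).trans ?_
  rw [ENNReal.mul_rpow_of_nonneg _ _ he.le, mul_assoc]
  refine mul_le_mul' le_rfl ((ENNReal.rpow_tsum_le _ he).trans_eq ?_)
  congr 2 with k
  rw [ENNReal.mul_rpow_of_nonneg _ _ he.le, mul_assoc]

theorem exists_oscillating_of_finite_energy {n : ℕ} [NeZero n] {p q r : ℝ} (hp : 1 < p)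
    (hq : 1 ≤ q) (hr : 0 < r) (hrq : r < q) (hrp : r * p = q)
    (hn : (n : ℝ) < (n + r) * (p / q)) :
    ∃ u : EuclideanSpace ℝ (Fin n) → ℝ, Continuous u ∧ (∀ x, 0 ≤ u x) ∧ (∀ x, u x ≤ 1) ∧
      (∀ (k : ℕ) x, ‖x.ofLp‖ = 2 * k + 1 → u x = 1) ∧ (∀ (k : ℕ) x, ‖x.ofLp‖ = 2 * k → u x = 0) ∧
      ∫⁻ x, fracDensity n q r u x ^ (p / q) < ∞ := by
  have hq0 : 0 < q := by linarith
  have he : 0 < p / q := by positivity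
  set w : ℕ → ℝ≥0∞ := fun k =>
    ((2 : ℝ≥0∞) ^ k) ^ (p / q) * (((2 : ℝ≥0∞) ^ k) ^ q) ^ (p / q) with hw
  have hwtop : ∀ k, w k ≠ ∞ := fun k => by
    have h1 : ((2 : ℝ≥0∞) ^ k) ^ q ≠ ∞ :=
      (ENNReal.rpow_lt_top_of_nonneg hq0.le (by finiteness)).ne
    exact ENNReal.mul_ne_top (ENNReal.rpow_lt_top_of_nonneg he.le (by finiteness)).ne
      (ENNReal.rpow_lt_top_of_nonneg he.le h1).ne
  choose v hvc hv0 hv1 hvin hvout hvE using fun k : ℕ =>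
    exists_sphere_bump (n := n) hp hq hr hrq hrp hn (R := 2 * k + 1)
      (by linarith [k.cast_nonneg (α := ℝ)])
      (δ := (w k)⁻¹ * 2⁻¹ ^ k)
      (mul_ne_zero (ENNReal.inv_ne_zero.2 (hwtop k)) (pow_ne_zero _ (by simp)))
  have hsupp : ∀ (m k : ℕ) x, ‖x.ofLp‖ ≤ m → v k x ≠ 0 → k < m := by
    intro m k x hx hk
    by_contra! hmk
    have : (m : ℝ) ≤ k := by exact_mod_cast hmk
    exact hk (hvin k x (by linarith [k.cast_nonneg (α := ℝ)]))
  have hsum : ∀ (m : ℕ) x, ‖x.ofLp‖ ≤ m → ∑ᶠ k, v k x = ∑ k ∈ Finset.range m, v k x := by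
    intro m x hx
    refine finsum_eq_sum_of_support_subset _ fun k hk => ?_
    simpa using hsupp m k x hx hk
  have hUc : Continuous fun x => ∑ᶠ k, v k x := by
    refine continuous_finsum hvc fun x => ?_
    obtain ⟨m, hm⟩ := exists_nat_gt ‖x.ofLp‖
    refine ⟨{y | ‖y.ofLp‖ < m}, ?_, (finite_lt_nat m).subset ?_⟩
    · exact (isOpen_lt (by fun_prop) continuous_const).mem_nhds hm
    · rintro k ⟨y, hky, hy⟩
      exact hsupp m k y (le_of_lt hy) hky
  have hU0 : ∀ x, 0 ≤ ∑ᶠ k, v k x := fun x => finsum_nonneg fun k => hv0 k x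
  refine ⟨fun x => min 1 (∑ᶠ k, v k x), by fun_prop, fun x => le_min zero_le_one (hU0 x),
    fun x => min_le_left _ _, fun k x hx => ?_, fun k x hx => ?_, ?_⟩
  · refine min_eq_left ?_
    rw [hsum (2 * k + 1) x (by rw [hx]; push_cast; rfl), ← hv1 k x hx]
    exact Finset.single_le_sum (f := fun k => v k x) (fun k _ => hv0 k x)
      (Finset.mem_range.2 (by omega))
  · have h1 : ∀ j, v j x = 0 := by
      intro j
      rcases le_or_gt k j with h | h
      · refine hvin j x ?_
        have : (k : ℝ) ≤ j := by exact_mod_cast h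
        linarith
      · refine hvout j x ?_
        have : (j : ℝ) + 1 ≤ k := by exact_mod_cast h
        linarith
    simp [h1]
  · have hdiff : ∀ x y, ‖min 1 (∑ᶠ k, v k x) - min 1 (∑ᶠ k, v k y)‖ₑ ≤
        ∑' k, ‖v k x - v k y‖ₑ := by
      intro x y
      obtain ⟨m, hm⟩ := exists_nat_ge (max ‖x.ofLp‖ ‖y.ofLp‖)
      calc _ ≤ ‖∑ᶠ k, v k x - ∑ᶠ k, v k y‖ₑ := by
            rw [enorm_le_iff_norm_le]
            simpa using abs_min_sub_min_le_max 1 (∑ᶠ k, v k x) 1 (∑ᶠ k, v k y)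
        _ = ‖∑ k ∈ Finset.range m, (v k x - v k y)‖ₑ := by
            rw [hsum m x ((le_max_left _ _).trans hm), hsum m y ((le_max_right _ _).trans hm),
              Finset.sum_sub_distrib]
        _ ≤ _ := enorm_sum_le _ _
        _ ≤ _ := ENNReal.sum_le_tsum _
    refine (lintegral_mono (fracDensity_rpow_le_tsum hq0 he (fun k => (hvc k).measurable)
      hdiff)).trans_lt ?_
    have hm : ∀ k, Measurable (fracDensity n q r (v k)) := fun k =>
      measurable_fracDensity (hvc k).measurable
    rw [lintegral_const_mul _ (by fun_prop), lintegral_tsum (by fun_prop)]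
    have hc : ((2 : ℝ≥0∞) ^ q) ^ (p / q) * 2 ^ (p / q) < ∞ :=
      ENNReal.mul_lt_top (ENNReal.rpow_lt_top_of_nonneg he.le
        (ENNReal.rpow_lt_top_of_nonneg hq0.le (by simp)).ne)
        (ENNReal.rpow_lt_top_of_nonneg he.le (by simp))
    refine ENNReal.mul_lt_top hc ?_
    calc _ ≤ ∑' k : ℕ, (2⁻¹ : ℝ≥0∞) ^ k := by
          refine ENNReal.tsum_le_tsum fun k => ?_
          rw [lintegral_const_mul _ (by fun_prop)]
          refine (mul_le_mul' le_rfl (hvE k)).trans ?_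
          rw [← mul_assoc]
          exact mul_le_of_le_one_left' (ENNReal.mul_inv_le_one (w k))
      _ < ∞ := by simp [ENNReal.tsum_geometric]

theorem ofReal_rpow_div_rpow_le {E : Type*} [NormedAddCommGroup E] (a : ℝ) (z : E) {q c : ℝ}
    (hq : 0 ≤ q) (hc : 0 < c) :
    ENNReal.ofReal (|a| ^ q / ‖z‖ ^ c) ≤ ‖a‖ₑ ^ q * ‖z‖ₑ ^ (-c) := by
  rcases eq_or_ne z 0 with rfl | hz
  · simp [Real.zero_rpow hc.ne']
  · rw [ENNReal.ofReal_div_of_pos (by positivity),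
      ← ENNReal.ofReal_rpow_of_nonneg (abs_nonneg _) hq,
      ← ENNReal.ofReal_rpow_of_pos (by positivity), ← Real.enorm_eq_ofReal_abs, ofReal_norm,
      ENNReal.rpow_neg, div_eq_mul_inv]

theorem not_tendsto_comp_of_oscillating {n : ℕ} {u : EuclideanSpace ℝ (Fin n) → ℝ}
    (h1 : ∀ (k : ℕ) x, ‖x.ofLp‖ = 2 * k + 1 → u x = 1)
    (h0 : ∀ (k : ℕ) x, ‖x.ofLp‖ = 2 * k → u x = 0) {γ : ℝ → EuclideanSpace ℝ (Fin n)}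
    (hγ : ContinuousOn γ (Ici 0)) (hγ' : Tendsto (fun t => ‖γ t‖) atTop atTop) (L : ℝ) :
    ¬ Tendsto (fun t => u (γ t)) atTop (nhds L) := by
  intro hL
  obtain ⟨K, hK⟩ := exists_norm_le_mul_norm_ofLp n
  have hN : Tendsto (fun t => ‖(γ t).ofLp‖) atTop atTop := by
    have hK' : Tendsto (fun t => (K + 1 : ℝ) * ‖(γ t).ofLp‖) atTop atTop :=
      tendsto_atTop_mono (fun t => (hK (γ t)).trans
        (mul_le_mul_of_nonneg_right (by linarith) (norm_nonneg _))) hγ'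
    exact (tendsto_const_mul_atTop_of_pos (by positivity)).1 hK'
  have hivt : ∀ T : ℝ, 0 ≤ T → ∀ y, ‖(γ T).ofLp‖ ≤ y → ∃ t, T ≤ t ∧ ‖(γ t).ofLp‖ = y := by
    intro T hT y hy
    obtain ⟨b, hb, hTb⟩ := ((hN.eventually_ge_atTop y).and (eventually_ge_atTop T)).exists
    have hc : ContinuousOn (fun t => ‖(γ t).ofLp‖) (Icc T b) :=
      ((PiLp.continuous_ofLp 2 _).comp_continuousOn
        (hγ.mono fun t ht => hT.trans ht.1)).norm
    obtain ⟨t, ht, hty⟩ := intermediate_value_Icc hTb hc ⟨hy, hb⟩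
    exact ⟨t, ht.1, hty⟩
  have hfreq : ∀ a : ℝ, (∀ M : ℝ, ∃ y, M ≤ y ∧
      ∀ x : EuclideanSpace ℝ (Fin n), ‖x.ofLp‖ = y → u x = a) →
      L = a := by
    intro a ha
    by_contra hne
    obtain ⟨T, hT⟩ := eventually_atTop.1 (hL.eventually_ne hne)
    obtain ⟨y, hy, hya⟩ := ha ‖(γ (max T 0)).ofLp‖
    obtain ⟨t, ht, hty⟩ := hivt (max T 0) (le_max_right _ _) y hy
    exact hT t ((le_max_left _ _).trans ht) (hya _ hty)
  have hL1 : L = 1 := hfreq 1 fun M => by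
    obtain ⟨k, hk⟩ := exists_nat_ge M
    exact ⟨2 * k + 1, by linarith [k.cast_nonneg (α := ℝ)], h1 k⟩
  have hL0 : L = 0 := hfreq 0 fun M => by
    obtain ⟨k, hk⟩ := exists_nat_ge M
    exact ⟨2 * k, by linarith [k.cast_nonneg (α := ℝ)], h0 k⟩
  linarith

theorem stmt11 (n : ℕ) (hn : 2 ≤ n) (s p q : ℝ) (hs0 : 0 < s) (hs1 : s < 1)
    (hp : 0 < p) (hsp1 : s * p = 1) (hq1 : 1 ≤ q)
    (hq2 : q < (n : ℝ) * p / ((n : ℝ) - s * p)) :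
    ∃ u : EuclideanSpace ℝ (Fin n) → ℝ, Continuous u ∧ (∃ C : ℝ, ∀ x, |u x| ≤ C) ∧ MemHomFrac n s p q u ∧
      ∀ γ : ℝ → EuclideanSpace ℝ (Fin n), ContinuousOn γ (Set.Ici 0) → γ 0 = 0 →
        Filter.Tendsto (fun t => ‖γ t‖) Filter.atTop Filter.atTop →
        ∀ L : ℝ, ¬ Filter.Tendsto (fun t => u (γ t)) Filter.atTop (nhds L) := by
  have hq0 : 0 < q := by linarith
  have : NeZero n := ⟨by omega⟩
  have hn2 : (2 : ℝ) ≤ n := by exact_mod_cast hn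
  have hr : 0 < s * q := by positivity
  have hp1 : 1 < p := by nlinarith
  have hpow : (n : ℝ) < (n + s * q) * (p / q) := by
    rw [hsp1, lt_div_iff₀ (by linarith)] at hq2
    have h1 : (n + s * q) * (p / q) = (n * p + s * p * q) / q := by field_simp
    rw [h1, hsp1, lt_div_iff₀ hq0]
    linarith
  obtain ⟨u, huc, hu0, hu1, hodd, heven, hE⟩ := exists_oscillating_of_finite_energy (n := n) hp1 hq1
    hr (by nlinarith) (by rw [mul_right_comm, hsp1, one_mul]) hpow
  refine ⟨u, huc, ⟨1, fun x => abs_le.2 ⟨by linarith [hu0 x], hu1 x⟩⟩, ⟨huc.measurable, ?_⟩,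
    fun γ hγ _ hγ' L => not_tendsto_comp_of_oscillating hodd heven hγ hγ' L⟩
  refine lt_of_le_of_lt (lintegral_mono fun x => ENNReal.rpow_le_rpow
    (lintegral_mono fun y => ?_) (by positivity)) hE
  exact ofReal_rpow_div_rpow_le (u x - u y) (x - y) hq0.le (by positivity)

end
end
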